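/- arXiv:1701.06317 — 12 statements merged into one kernel-verified Lean document; each statement's English description precedes it below -/
import Mathlib

section
/- For every subset q of E, the maximum of Σ_{e∈q} c_e over c ∈ U is attained, and the worst-case cost satisfies zRC(q) = Σ_{e∈q} n_e + Σ_{j=1}^{Γ} kmax_j(q); that is, the worst case over the cardinality-constrained uncertainty set equals the nominal cost of q plus the sum of the min(Γ, |q|) largest interval lengths of elements of q. -/
open Finset

/-- The cardinality-constrained uncertainty set: all cost functions `c` with
`n e ≤ c e ≤ n e + δ e` for every element, and at most `Γ` elements with `c e > n e`. -/
def Uset {E : Type*} [Fintype E] [DecidableEq E] (n δ : E → ℝ) (Γ : ℕ) : Set (E → ℝ) :=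
  {c | (∀ e, n e ≤ c e ∧ c e ≤ n e + δ e) ∧
    (Finset.univ.filter fun e => n e < c e).card ≤ Γ}

/-- `kmax δ j q`: the `j`-th largest value of the multiset `{δ e : e ∈ q}`
(counted with multiplicity), and `0` if `|q| < j`. -/
noncomputable def kmax {E : Type*} (δ : E → ℝ) (j : ℕ) (q : Finset E) : ℝ :=
  ((q.val.map δ).sort (· ≥ ·)).getD (j - 1) 0

/-- The sum of the first `k` entries of a list, padded with zeros. -/
theorem sum_Icc_getD_eq_sum_take (L : List ℝ) (k : ℕ) :
    ∑ j ∈ Finset.Icc 1 k, L.getD (j - 1) 0 = (L.take k).sum := by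
  induction k with
  | zero => simp
  | succ k ih =>
    rw [Finset.sum_Icc_succ_top (by omega), ih]
    by_cases hk : k < L.length
    · rw [List.take_add_one]
      simp [hk]
    · rw [List.take_of_length_le (by omega), List.take_of_length_le (by omega)]
      simp [List.getElem?_eq_none (not_lt.mp hk)]

/-- In a nonincreasing list of nonnegative reals, the first `k` entries have the largest sum
among all sublists of length at most `k`. -/
theorem List.Sublist.sum_le_sum_take {L' L : List ℝ} {k : ℕ} (hsub : L'.Sublist L)
    (hlen : L'.length ≤ k) (hL : L.Pairwise (· ≥ ·)) (hnn : ∀ x ∈ L, 0 ≤ x) :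
    L'.sum ≤ (L.take k).sum := by
  induction L generalizing L' k with
  | nil => simp [List.sublist_nil.mp hsub]
  | cons a L ih =>
    cases L' with
    | nil => exact List.sum_nonneg fun x hx => hnn x (List.mem_of_mem_take hx)
    | cons b L' =>
      obtain ⟨k, rfl⟩ : ∃ m, k = m + 1 := ⟨k - 1, by simp at hlen; omega⟩
      have hba : b ≤ a := by
        rcases List.mem_cons.mp (hsub.subset List.mem_cons_self) with h | h
        · exact h.le
        · exact (List.pairwise_cons.mp hL).1 b h
      have := ih (k := k) hsub.tail (by simpa using hlen) hL.of_cons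
        fun x hx => hnn x (List.mem_cons_of_mem _ hx)
      simp only [List.sum_cons, List.take_succ_cons, List.tail_cons] at this ⊢
      linarith

/-- A finset can be enumerated so that its interval lengths appear in nonincreasing order. -/
theorem exists_sorted_enumeration {E : Type*} [DecidableEq E] (δ : E → ℝ) (q : Finset E) :
    ∃ l : List E, l.Nodup ∧ l.toFinset = q ∧ (l.map δ).Pairwise (· ≥ ·) ∧
      (q.val.map δ).sort (· ≥ ·) = l.map δ := by
  classical
  let l := q.toList.mergeSort fun a b => decide (δ a ≥ δ b)
  have hperm : l.Perm q.toList := List.mergeSort_perm _ _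
  have hsorted : (l.map δ).Pairwise (· ≥ ·) := by
    rw [List.pairwise_map]
    refine (List.pairwise_mergeSort ?_ ?_ q.toList).imp fun h => of_decide_eq_true h
    · intro a b c hab hbc
      simp only [decide_eq_true_eq] at *
      exact hbc.trans hab
    · intro a b
      simpa using le_total (δ b) (δ a)
  refine ⟨l, hperm.nodup_iff.mpr q.nodup_toList, ?_, hsorted, ?_⟩
  · rw [List.toFinset_eq_of_perm _ _ hperm, Finset.toList_toFinset]
  · refine List.Perm.eq_of_pairwise' (Multiset.pairwise_sort _ _) hsorted ?_
    rw [← Multiset.coe_eq_coe, Multiset.sort_eq, ← Multiset.map_coe,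
      Multiset.coe_eq_coe.mpr hperm, Finset.coe_toList]

/-- The maximum of `∑_{e ∈ q} c e` over `c` in the cardinality-constrained uncertainty set
is attained, and equals the nominal cost of `q` plus the sum of the `min(Γ,|q|)` largest
interval lengths of elements of `q`. -/
theorem stmt0 {E : Type*} [Fintype E] [DecidableEq E] [Nonempty E]
    (Q : Set (Finset E)) (hQ : Q.Nonempty)
    (n δ : E → ℝ) (hδ : ∀ e, 0 ≤ δ e)
    (Γ : ℕ) (hΓ1 : 1 ≤ Γ) (hΓ2 : Γ ≤ Fintype.card E)
    (q : Finset E) :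
    IsGreatest {x : ℝ | ∃ c ∈ Uset n δ Γ, x = ∑ e ∈ q, c e}
      ((∑ e ∈ q, n e) + ∑ j ∈ Finset.Icc 1 Γ, kmax δ j q) := by
  obtain ⟨l, hnd, rfl, hsorted, hsort⟩ := exists_sorted_enumeration δ q
  have hk : ∑ j ∈ Finset.Icc 1 Γ, kmax δ j l.toFinset = ((l.map δ).take Γ).sum := by
    simp only [kmax, hsort]
    exact sum_Icc_getD_eq_sum_take _ _
  rw [hk]
  constructor
  · have hsub : (l.take Γ).toFinset ⊆ l.toFinset := fun e he =>
      List.mem_toFinset.mpr (List.mem_of_mem_take (List.mem_toFinset.mp he))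
    refine ⟨fun e => n e + if e ∈ (l.take Γ).toFinset then δ e else 0, ⟨fun e => ?_, ?_⟩, ?_⟩
    · have := hδ e
      dsimp only
      split_ifs <;> constructor <;> linarith
    · calc _ ≤ (l.take Γ).toFinset.card := by
            refine Finset.card_le_card fun e he => ?_
            by_contra h
            simp only [Finset.mem_filter, h, if_false, add_zero, lt_irrefl, and_false] at he
        _ ≤ (l.take Γ).length := List.toFinset_card_le _
        _ ≤ Γ := List.length_take_le _ _
    · rw [Finset.sum_add_distrib, Finset.sum_ite_mem, Finset.inter_eq_right.mpr hsub,
        List.sum_toFinset _ (hnd.sublist (List.take_sublist _ _)), List.map_take]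
  · rintro x ⟨c, ⟨hc, hcard⟩, rfl⟩
    have hraised : ((l.filter fun e => n e < c e).map δ).sum ≤ ((l.map δ).take Γ).sum := by
      refine List.Sublist.sum_le_sum_take (List.filter_sublist.map δ) ?_ hsorted ?_
      · rw [List.length_map, ← List.toFinset_card_of_nodup (hnd.filter _)]
        refine (Finset.card_le_card fun e he => ?_).trans hcard
        simp only [List.mem_toFinset, List.mem_filter, decide_eq_true_eq] at he
        simpa using he.2
      · simp only [List.mem_map]
        rintro _ ⟨e, -, rfl⟩
        exact hδ e
    rw [← List.sum_toFinset _ (hnd.filter _), List.toFinset_filter] at hraised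
    simp only [decide_eq_true_eq, Finset.sum_filter] at hraised
    have hle : ∑ e ∈ l.toFinset, c e ≤
        ∑ e ∈ l.toFinset, (n e + if n e < c e then δ e else 0) := by
      refine Finset.sum_le_sum fun e _ => ?_
      split_ifs with h
      · exact (hc e).2
      · simpa using h
    rw [Finset.sum_add_distrib] at hle
    linarith
end

section
/- For every q ∈ Q and every l ∈ {1, …, m+1}, the worst-case cost is overestimated by the subproblem objective: zRC(q) ≤ zBS^l(q). -/
open Finset

/-- The worst-case cost `zRC(q) = max_{c ∈ U} ∑_{e ∈ q} c e`. -/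
noncomputable def zRC {E : Type*} [Fintype E] [DecidableEq E] (n δ : E → ℝ) (Γ : ℕ)
    (q : Finset E) : ℝ :=
  sSup {x : ℝ | ∃ c ∈ Uset n δ Γ, x = ∑ e ∈ q, c e}

/-- `δ̄_l` for `l ∈ {1,…,m}` (1-based), and `δ̄_{m+1} = 0`, where the enumeration
`e : Fin m ≃ E` lists the elements in order of decreasing interval length. -/
noncomputable def dbar {E : Type*} [Fintype E] (δ : E → ℝ)
    (e : Fin (Fintype.card E) ≃ E) (l : ℕ) : ℝ :=
  if h : l - 1 < Fintype.card E then δ (e ⟨l - 1, h⟩) else 0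

/-- The subproblem objective
`zBS^l(q) = ∑_{e∈q} n e + Γ·δ̄_l + ∑_{e_j ∈ q, j ≤ l} (δ_{e_j} − δ̄_l)`,
where `e_j` has 1-based index `j`, i.e. `j = (e.symm x : ℕ) + 1`. -/
noncomputable def zBS {E : Type*} [Fintype E] [DecidableEq E] (n δ : E → ℝ) (Γ : ℕ)
    (e : Fin (Fintype.card E) ≃ E) (l : ℕ) (q : Finset E) : ℝ :=
  (∑ x ∈ q, n x) + Γ * dbar δ e l +
    ∑ x ∈ q.filter (fun x => ((e.symm x : ℕ) + 1 ≤ l)), (δ x - dbar δ e l)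

section Overestimate

variable {E : Type*} [Fintype E]

lemma dbar_nonneg {δ : E → ℝ} (hδ : ∀ x, 0 ≤ δ x) (e : Fin (Fintype.card E) ≃ E) (l : ℕ) :
    0 ≤ dbar δ e l := by
  unfold dbar
  split_ifs
  exacts [hδ _, le_rfl]

lemma dbar_le_of_index_le {δ : E → ℝ} (hδ : ∀ x, 0 ≤ δ x) {e : Fin (Fintype.card E) ≃ E}
    (hsort : ∀ i j : Fin (Fintype.card E), i ≤ j → δ (e j) ≤ δ (e i)) {l : ℕ} {x : E}
    (hx : (e.symm x : ℕ) + 1 ≤ l) : dbar δ e l ≤ δ x := by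
  unfold dbar
  split_ifs with h
  · simpa using hsort (e.symm x) ⟨l - 1, h⟩ (Fin.le_def.mpr (by simp only; omega))
  · exact hδ x

lemma le_dbar_of_lt_index {δ : E → ℝ} {e : Fin (Fintype.card E) ≃ E}
    (hsort : ∀ i j : Fin (Fintype.card E), i ≤ j → δ (e j) ≤ δ (e i)) {l : ℕ} {x : E}
    (hx : l < (e.symm x : ℕ) + 1) : δ x ≤ dbar δ e l := by
  have hlt := (e.symm x).isLt
  have h : l - 1 < Fintype.card E := by omega
  rw [dbar, dif_pos h]
  simpa using hsort ⟨l - 1, h⟩ (e.symm x) (Fin.le_def.mpr (by simp only; omega))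

variable [DecidableEq E]

lemma nominal_mem_Uset (n : E → ℝ) {δ : E → ℝ} (hδ : ∀ x, 0 ≤ δ x) (Γ : ℕ) :
    n ∈ Uset n δ Γ :=
  ⟨fun x => ⟨le_rfl, le_add_of_nonneg_right (hδ x)⟩, by simp⟩

/-- Every scenario in the uncertainty set costs at most the subproblem objective. -/
lemma sum_le_zBS {n δ : E → ℝ} (hδ : ∀ x, 0 ≤ δ x) {Γ : ℕ} {e : Fin (Fintype.card E) ≃ E}
    (hsort : ∀ i j : Fin (Fintype.card E), i ≤ j → δ (e j) ≤ δ (e i)) (q : Finset E) (l : ℕ)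
    {c : E → ℝ} (hc : c ∈ Uset n δ Γ) : ∑ x ∈ q, c x ≤ zBS n δ Γ e l q := by
  obtain ⟨hbound, hcard⟩ := hc
  have hd := dbar_nonneg hδ e l
  have hpoint : ∀ x ∈ q, c x ≤ n x + (if n x < c x then dbar δ e l else 0) +
      (if (e.symm x : ℕ) + 1 ≤ l then δ x - dbar δ e l else 0) := by
    intro x _
    have hx := (hbound x).2
    split_ifs with h₁ h₂ h₂
    · linarith
    · linarith [le_dbar_of_lt_index hsort (not_le.mp h₂)]
    · linarith [dbar_le_of_index_le hδ hsort h₂]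
    · linarith
  have hdeviate : ∑ x ∈ q, (if n x < c x then dbar δ e l else 0) ≤ Γ * dbar δ e l := by
    rw [← Finset.sum_filter, Finset.sum_const, nsmul_eq_mul]
    have hsub := Finset.card_le_card
      (Finset.filter_subset_filter (fun x => n x < c x) (Finset.subset_univ q))
    exact mul_le_mul_of_nonneg_right (by exact_mod_cast hsub.trans hcard) hd
  calc ∑ x ∈ q, c x ≤ _ := Finset.sum_le_sum hpoint
    _ ≤ zBS n δ Γ e l q := by
      rw [Finset.sum_add_distrib, Finset.sum_add_distrib, zBS, Finset.sum_filter]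
      gcongr

end Overestimate

/-- For every `q ∈ Q` and `l ∈ {1,…,m+1}`, the worst-case cost is overestimated by the
subproblem objective: `zRC(q) ≤ zBS^l(q)`. -/
theorem stmt1 {E : Type*} [Fintype E] [DecidableEq E] [Nonempty E]
    (Q : Set (Finset E)) (hQ : Q.Nonempty)
    (n δ : E → ℝ) (hδ : ∀ x, 0 ≤ δ x)
    (Γ : ℕ) (hΓ1 : 1 ≤ Γ) (hΓ2 : Γ ≤ Fintype.card E)
    (e : Fin (Fintype.card E) ≃ E)
    (hsort : ∀ i j : Fin (Fintype.card E), i ≤ j → δ (e j) ≤ δ (e i))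
    (q : Finset E) (hq : q ∈ Q)
    (l : ℕ) (hl1 : 1 ≤ l) (hl2 : l ≤ Fintype.card E + 1) :
    zRC n δ Γ q ≤ zBS n δ Γ e l q := by
  refine csSup_le ⟨_, n, nominal_mem_Uset n hδ Γ, rfl⟩ ?_
  rintro _ ⟨c, hc, rfl⟩
  exact sum_le_zBS hδ hsort q l hc
end

section
/- For every q ∈ Q there exists an index l with Γ ≤ l ≤ m+1 such that zBS^l(q) = zRC(q). -/
open Finset

/-- Weak duality together with complementary slackness: if `T ⊆ q` has at most `Γ` elements and
collects the elements of `q` with interval length above the threshold `d`, then raising the costs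
exactly on `T` is a worst case for `q`, and its value is that of the dual objective at `d`. -/
lemma zRC_eq_of_threshold {E : Type*} [Fintype E] [DecidableEq E] {n δ : E → ℝ} {Γ : ℕ}
    {q T : Finset E} {d : ℝ} (hδ : ∀ x, 0 ≤ δ x) (hT : T ⊆ q) (hcard : T.card ≤ Γ)
    (hd : 0 ≤ d) (hle : ∀ x ∈ T, d ≤ δ x) (hge : ∀ x ∈ q, x ∉ T → δ x ≤ d)
    (hslack : Γ * d = T.card * d) :
    zRC n δ Γ q = (∑ x ∈ q, n x) + Γ * d + ∑ x ∈ T, (δ x - d) := by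
  have hsum (f : E → ℝ) : ∑ x ∈ q, (if x ∈ T then f x else 0) = ∑ x ∈ T, f x := by
    rw [← Finset.sum_filter, Finset.filter_mem_eq_inter, Finset.inter_eq_right.mpr hT]
  refine IsGreatest.csSup_eq ⟨⟨fun x => n x + if x ∈ T then δ x else 0, ⟨fun x => ?_, ?_⟩, ?_⟩, ?_⟩
  · have := hδ x
    dsimp only
    split_ifs <;> constructor <;> linarith
  · refine (Finset.card_le_card fun x hx => ?_).trans hcard
    by_contra hxT
    simp [hxT] at hx
  · rw [Finset.sum_add_distrib, hsum, Finset.sum_sub_distrib, Finset.sum_const, nsmul_eq_mul,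
      hslack]
    ring
  · rintro _ ⟨c, ⟨hc, hcΓ⟩, rfl⟩
    have hraised : ∑ x ∈ q, (if n x < c x then d else 0) ≤ Γ * d := by
      rw [← Finset.sum_filter, Finset.sum_const, nsmul_eq_mul]
      refine mul_le_mul_of_nonneg_right ?_ hd
      exact_mod_cast (Finset.card_le_card
        (Finset.filter_subset_filter _ (Finset.subset_univ q))).trans hcΓ
    calc ∑ x ∈ q, c x
        ≤ ∑ x ∈ q, (n x + (if n x < c x then d else 0) + if x ∈ T then δ x - d else 0) := by
          refine Finset.sum_le_sum fun x hx => ?_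
          have h1 := (hc x).2
          have h2 := hle x
          have h3 := hge x hx
          split_ifs with ha hb hb
          · linarith
          · linarith [h3 hb]
          · linarith [h2 hb]
          · linarith
      _ ≤ _ := by
          rw [Finset.sum_add_distrib, Finset.sum_add_distrib, hsum]
          linarith

/-- Passing from one initial segment of an enumeration to the next adds at most one element of a
finset, so every cardinality up to `q.card` is attained by an initial segment of `q`. -/
lemma exists_card_filter_lt_eq {E : Type*} [DecidableEq E] {m : ℕ} (e : Fin m ≃ E)
    (q : Finset E) {k : ℕ} (hk : k ≤ q.card) :
    ∃ l ≤ m, (q.filter fun x => (e.symm x : ℕ) + 1 ≤ l).card = k := by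
  have hstep (l : ℕ) : (q.filter fun x => (e.symm x : ℕ) + 1 ≤ l + 1).card ≤
      (q.filter fun x => (e.symm x : ℕ) + 1 ≤ l).card + 1 := by
    have hone : (q.filter fun x => (e.symm x : ℕ) = l).card ≤ 1 := by
      refine Finset.card_le_one.mpr fun a ha b hb => ?_
      rw [Finset.mem_filter] at ha hb
      exact e.symm.injective (Fin.ext (ha.2.trans hb.2.symm))
    refine (Finset.card_le_card (t := (q.filter fun x => (e.symm x : ℕ) + 1 ≤ l) ∪
      q.filter fun x => (e.symm x : ℕ) = l) fun x hx => ?_).trans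
      ((Finset.card_union_le _ _).trans (by omega))
    simp only [Finset.mem_union, Finset.mem_filter] at hx ⊢
    have := hx.2
    by_cases (e.symm x : ℕ) = l
    · tauto
    · exact Or.inl ⟨hx.1, by omega⟩
  have hfull : k ≤ (q.filter fun x => (e.symm x : ℕ) + 1 ≤ m).card := by
    rwa [Finset.filter_true_of_mem fun x _ => Nat.succ_le_of_lt (e.symm x).isLt]
  have hex : ∃ l, k ≤ (q.filter fun x => (e.symm x : ℕ) + 1 ≤ l).card :=
    ⟨m, hfull⟩
  refine ⟨Nat.find hex, Nat.find_min' hex hfull, le_antisymm ?_ (Nat.find_spec hex)⟩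
  · rcases h : Nat.find hex with _ | l
    · simp
    · have := Nat.find_min hex (m := l) (by omega)
      have := hstep l
      omega

/-- An initial segment of length `l` contains at most `l` elements of a finset. -/
lemma card_filter_lt_le {E : Type*} {m : ℕ} (e : Fin m ≃ E) (q : Finset E) (l : ℕ) :
    (q.filter fun x => (e.symm x : ℕ) + 1 ≤ l).card ≤ l := by
  calc _ ≤ (Finset.range l).card := by
        refine Finset.card_le_card_of_injOn (fun x => (e.symm x : ℕ)) (fun x hx => ?_)
          fun a _ b _ hab => e.symm.injective (Fin.ext hab)
        simp only [Finset.coe_filter, Set.mem_ofPred_eq] at hx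
        simpa using hx.2
    _ = l := Finset.card_range l

/-- For every `q ∈ Q` there exists an index `l` with `Γ ≤ l ≤ m+1` such that
`zBS^l(q) = zRC(q)`. -/
theorem stmt2 {E : Type*} [Fintype E] [DecidableEq E] [Nonempty E]
    (Q : Set (Finset E)) (hQ : Q.Nonempty)
    (n δ : E → ℝ) (hδ : ∀ x, 0 ≤ δ x)
    (Γ : ℕ) (hΓ1 : 1 ≤ Γ) (hΓ2 : Γ ≤ Fintype.card E)
    (e : Fin (Fintype.card E) ≃ E)
    (hsort : ∀ i j : Fin (Fintype.card E), i ≤ j → δ (e j) ≤ δ (e i))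
    (q : Finset E) (hq : q ∈ Q) :
    ∃ l : ℕ, Γ ≤ l ∧ l ≤ Fintype.card E + 1 ∧ zBS n δ Γ e l q = zRC n δ Γ q := by
  by_cases hcard : Γ ≤ q.card
  · obtain ⟨l, hlm, hl⟩ := exists_card_filter_lt_eq e q hcard
    have hΓl : Γ ≤ l := hl ▸ card_filter_lt_le e q l
    have hlt : l - 1 < Fintype.card E := by omega
    have hdbar : dbar δ e l = δ (e ⟨l - 1, hlt⟩) := dif_pos hlt
    refine ⟨l, hΓl, by omega, (zRC_eq_of_threshold hδ (Finset.filter_subset _ _) hl.le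
      (hdbar ▸ hδ _) (fun x hx => ?_) (fun x hxq hx => ?_) (by rw [hl])).symm⟩
    · have hxl := (Finset.mem_filter.mp hx).2
      simpa [hdbar] using hsort (e.symm x) ⟨l - 1, hlt⟩ (Fin.le_def.mpr (by dsimp only; omega))
    · have hxl : ¬ (e.symm x : ℕ) + 1 ≤ l := fun h => hx (Finset.mem_filter.mpr ⟨hxq, h⟩)
      simpa [hdbar] using hsort ⟨l - 1, hlt⟩ (e.symm x) (Fin.le_def.mpr (by dsimp only; omega))
  · have hdbar : dbar δ e (Fintype.card E + 1) = 0 := dif_neg (by simp)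
    have hfilter : (q.filter fun x => (e.symm x : ℕ) + 1 ≤ Fintype.card E + 1) = q :=
      Finset.filter_true_of_mem fun x _ => by omega
    refine ⟨Fintype.card E + 1, by omega, le_rfl, ?_⟩
    rw [zBS, hdbar, hfilter]
    exact (zRC_eq_of_threshold hδ subset_rfl (by omega) le_rfl (fun x _ => hδ x)
      (fun x hx hx' => absurd hx hx') (by simp)).symm
end

section
/- If 1 ≤ l ≤ l+h ≤ m+1 and δ̄_l = δ̄_{l+h}, then the subproblem objectives coincide as functions: zBS^l(q) = zBS^{l+1}(q) = … = zBS^{l+h}(q) for every q ⊆ E. -/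
open Finset

/-- The sorted interval lengths, extended by `0`, form an antitone sequence. -/
lemma dbar_antitone {E : Type*} [Fintype E] {δ : E → ℝ} (hδ : ∀ x, 0 ≤ δ x)
    {e : Fin (Fintype.card E) ≃ E}
    (hsort : ∀ i j : Fin (Fintype.card E), i ≤ j → δ (e j) ≤ δ (e i)) :
    Antitone (dbar δ e) := by
  intro a b hab
  unfold dbar
  split_ifs with hb ha
  · exact hsort _ _ (Fin.mk_le_mk.2 (Nat.sub_le_sub_right hab 1))
  · omega
  · exact hδ _
  · exact le_rfl

lemma dbar_symm_add_one {E : Type*} [Fintype E] (δ : E → ℝ)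
    (e : Fin (Fintype.card E) ≃ E) (x : E) :
    dbar δ e ((e.symm x : ℕ) + 1) = δ x := by
  simp [dbar]

/-- Equal threshold values give equal subproblem objectives: the additional summands vanish. -/
lemma zBS_eq_of_dbar_eq {E : Type*} [Fintype E] [DecidableEq E] {n δ : E → ℝ} {Γ : ℕ}
    {e : Fin (Fintype.card E) ≃ E} (hanti : Antitone (dbar δ e)) {l j : ℕ} (hlj : l ≤ j)
    (heq : dbar δ e j = dbar δ e l) (q : Finset E) :
    zBS n δ Γ e j q = zBS n δ Γ e l q := by
  unfold zBS
  rw [heq]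
  congr 1
  symm
  refine Finset.sum_subset (fun x hx => ?_) (fun x hx hxl => ?_)
  · simp only [Finset.mem_filter] at hx ⊢
    exact ⟨hx.1, hx.2.trans hlj⟩
  · simp only [Finset.mem_filter, not_and, not_le] at hx hxl
    have h_upper := hanti (hxl hx.1).le
    have h_lower := hanti hx.2
    rw [dbar_symm_add_one] at h_upper h_lower
    linarith

/-- If `1 ≤ l ≤ l+h ≤ m+1` and `δ̄_l = δ̄_{l+h}`, then the subproblem objectives coincide
as functions: `zBS^j(q) = zBS^l(q)` for all `l ≤ j ≤ l+h` and all `q ⊆ E`. -/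
theorem stmt4 {E : Type*} [Fintype E] [DecidableEq E] [Nonempty E]
    (Q : Set (Finset E)) (hQ : Q.Nonempty)
    (n δ : E → ℝ) (hδ : ∀ x, 0 ≤ δ x)
    (Γ : ℕ) (hΓ1 : 1 ≤ Γ) (hΓ2 : Γ ≤ Fintype.card E)
    (e : Fin (Fintype.card E) ≃ E)
    (hsort : ∀ i j : Fin (Fintype.card E), i ≤ j → δ (e j) ≤ δ (e i))
    (l h : ℕ) (hl1 : 1 ≤ l) (hlh : l + h ≤ Fintype.card E + 1)
    (heq : dbar δ e l = dbar δ e (l + h)) :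
    ∀ q : Finset E, ∀ j : ℕ, l ≤ j → j ≤ l + h → zBS n δ Γ e j q = zBS n δ Γ e l q := by
  intro q j hlj hjh
  have hanti := dbar_antitone hδ hsort
  exact zBS_eq_of_dbar_eq hanti hlj (le_antisymm (hanti hlj) (heq.trans_le (hanti hjh))) q
end

section
/- Under objective independent element order, for every q ∈ Q, every l ∈ {1, …, m+1}, and every i ∈ {1, …, k}: zRC_i(q) ≤ zBS^l_i(q). -/
open Finset

/-- The multi-objective cardinality-constrained uncertainty set: all cost functions `c` with
`n e i ≤ c e i ≤ n e i + δ e i` for all `e, i`, and, for each objective `i`,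
at most `Γ i` elements with `c e i > n e i`. -/
def Uk {E : Type*} [Fintype E] [DecidableEq E] {k : ℕ} (n δ : E → Fin k → ℝ)
    (Γ : Fin k → ℕ) : Set (E → Fin k → ℝ) :=
  {c | (∀ e i, n e i ≤ c e i ∧ c e i ≤ n e i + δ e i) ∧
    ∀ i, (Finset.univ.filter fun e => n e i < c e i).card ≤ Γ i}

/-- The worst-case cost vector: `zRC_i(q) = max_{c ∈ U} ∑_{e ∈ q} c e i`. -/
noncomputable def zRCk {E : Type*} [Fintype E] [DecidableEq E] {k : ℕ}
    (n δ : E → Fin k → ℝ) (Γ : Fin k → ℕ) (q : Finset E) : Fin k → ℝ :=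
  fun i => sSup {x : ℝ | ∃ c ∈ Uk n δ Γ, x = ∑ e ∈ q, c e i}

/-- `δ̄_{l,i}` for `l ∈ {1,…,m}` (1-based), and `δ̄_{m+1} = 0`, where the enumeration
`e : Fin m ≃ E` lists the elements in order of (componentwise) decreasing interval length. -/
noncomputable def dbarK {E : Type*} [Fintype E] {k : ℕ} (δ : E → Fin k → ℝ)
    (e : Fin (Fintype.card E) ≃ E) (l : ℕ) (i : Fin k) : ℝ :=
  if h : l - 1 < Fintype.card E then δ (e ⟨l - 1, h⟩) i else 0

/-- The multi-objective subproblem objective (objective independent element order):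
`zBS^l_i(q) = ∑_{e∈q} n e i + Γ_i·δ̄_{l,i} + ∑_{e_j ∈ q, j ≤ l} (δ_{e_j,i} − δ̄_{l,i})`,
where `e_j` has 1-based index `j = (e.symm x : ℕ) + 1`. -/
noncomputable def zBSk {E : Type*} [Fintype E] [DecidableEq E] {k : ℕ}
    (n δ : E → Fin k → ℝ) (Γ : Fin k → ℕ) (e : Fin (Fintype.card E) ≃ E)
    (l : ℕ) (q : Finset E) : Fin k → ℝ :=
  fun i => (∑ x ∈ q, n x i) + Γ i * dbarK δ e l i +
    ∑ x ∈ q.filter (fun x => ((e.symm x : ℕ) + 1 ≤ l)), (δ x i - dbarK δ e l i)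

theorem dbarK_nonneg {E : Type*} [Fintype E] {k : ℕ} {δ : E → Fin k → ℝ}
    (hδ : ∀ x i, 0 ≤ δ x i) (e : Fin (Fintype.card E) ≃ E) (l : ℕ) (i : Fin k) :
    0 ≤ dbarK δ e l i := by
  unfold dbarK
  split_ifs
  exacts [hδ _ _, le_rfl]

theorem dbarK_le_of_index_le {E : Type*} [Fintype E] {k : ℕ} {δ : E → Fin k → ℝ}
    (hδ : ∀ x i, 0 ≤ δ x i) {e : Fin (Fintype.card E) ≃ E} {i : Fin k}
    (hsort : ∀ a b, a ≤ b → δ (e b) i ≤ δ (e a) i)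
    {l : ℕ} {x : E} (hx : (e.symm x : ℕ) + 1 ≤ l) : dbarK δ e l i ≤ δ x i := by
  unfold dbarK
  split_ifs with h
  · simpa using hsort (e.symm x) ⟨l - 1, h⟩ (Fin.le_def.2 (by dsimp only; omega))
  · exact hδ x i

theorem le_dbarK_of_lt_index {E : Type*} [Fintype E] {k : ℕ} {δ : E → Fin k → ℝ}
    {e : Fin (Fintype.card E) ≃ E} {i : Fin k}
    (hsort : ∀ a b, a ≤ b → δ (e b) i ≤ δ (e a) i)
    {l : ℕ} {x : E} (hx : l < (e.symm x : ℕ) + 1) : δ x i ≤ dbarK δ e l i := by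
  have hlt := (e.symm x).isLt
  have h : l - 1 < Fintype.card E := by omega
  rw [dbarK, dif_pos h]
  simpa using hsort ⟨l - 1, h⟩ (e.symm x) (Fin.le_def.2 (by dsimp only; omega))

/-- Under objective independent element order, for every `q ∈ Q`, `l ∈ {1,…,m+1}` and every
objective `i`: `zRC_i(q) ≤ zBS^l_i(q)`. -/
theorem stmt7 {E : Type*} [Fintype E] [DecidableEq E] [Nonempty E] {k : ℕ} (hk : 0 < k)
    (Q : Set (Finset E)) (hQ : Q.Nonempty)
    (n δ : E → Fin k → ℝ) (hδ : ∀ x i, 0 ≤ δ x i)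
    (Γ : Fin k → ℕ) (hΓ1 : ∀ i, 1 ≤ Γ i) (hΓ2 : ∀ i, Γ i ≤ Fintype.card E)
    (hΓeq : ∀ i j, Γ i = Γ j)
    (e : Fin (Fintype.card E) ≃ E)
    (hsort : ∀ i : Fin k, ∀ a b : Fin (Fintype.card E), a ≤ b → δ (e b) i ≤ δ (e a) i)
    (q : Finset E) (hq : q ∈ Q)
    (l : ℕ) (hl1 : 1 ≤ l) (hl2 : l ≤ Fintype.card E + 1) (i : Fin k) :
    zRCk n δ Γ q i ≤ zBSk n δ Γ e l q i := by
  refine csSup_le ⟨_, n, ⟨fun x j => ⟨le_rfl, le_add_of_nonneg_right (hδ x j)⟩, by simp⟩, rfl⟩ ?_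
  rintro _ ⟨c, ⟨hc, hcard⟩, rfl⟩
  set D := dbarK δ e l i with hD
  have hD0 : 0 ≤ D := dbarK_nonneg hδ e l i
  have hpoint : ∀ x ∈ q, c x i ≤ n x i + (if n x i < c x i then D else 0) +
      (if (e.symm x : ℕ) + 1 ≤ l then δ x i - D else 0) := by
    intro x _
    have hcx := (hc x i).2
    split_ifs with h₁ h₂ h₂
    · linarith
    · linarith [le_dbarK_of_lt_index (hsort i) (not_le.1 h₂)]
    · linarith [dbarK_le_of_index_le hδ (hsort i) h₂]
    · linarith
  have hcount : ∑ x ∈ q, (if n x i < c x i then D else 0) ≤ Γ i * D := by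
    rw [← Finset.sum_filter, Finset.sum_const, nsmul_eq_mul]
    refine mul_le_mul_of_nonneg_right (Nat.cast_le.2 ?_) hD0
    exact (Finset.card_le_card (Finset.filter_subset_filter _ (Finset.subset_univ q))).trans
      (hcard i)
  have hsum := Finset.sum_le_sum hpoint
  rw [Finset.sum_add_distrib, Finset.sum_add_distrib, ← Finset.sum_filter
    (fun x => (e.symm x : ℕ) + 1 ≤ l)] at hsum
  simp only [zBSk, ← hD]
  linarith
end

section
/- Assume objective independent element order. Let q ∈ Q with |q| ≥ Γ_1, and let l ∈ {1, …, m} be the Γ_1-th smallest index of an element of q, i.e., e_l ∈ q and |{j ≤ l : e_j ∈ q}| = Γ_1. Then zBS^l(q) = zBS^{l+1}(q) = zRC(q) (equality of vectors in ℝ^k). -/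
open Finset

/-- The robust value of `q` when `A ⊆ q` collects the `Γ i` elements of `q` with the largest
interval lengths, `d i` being a threshold between the lengths in `A` and those in `q \ A`. -/
lemma zRCk_apply_eq {E : Type*} [Fintype E] [DecidableEq E] {k : ℕ} {n δ : E → Fin k → ℝ}
    (hδ : ∀ x i, 0 ≤ δ x i) {Γ : Fin k → ℕ} {q A : Finset E} (hAq : A ⊆ q)
    (hA : ∀ i, A.card = Γ i) {d : Fin k → ℝ} (hd : ∀ i, 0 ≤ d i)
    (hin : ∀ i, ∀ x ∈ A, d i ≤ δ x i) (hout : ∀ i, ∀ x ∈ q, x ∉ A → δ x i ≤ d i) (i : Fin k) :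
    zRCk n δ Γ q i = ∑ x ∈ q, n x i + ∑ x ∈ A, δ x i := by
  refine IsGreatest.csSup_eq ⟨?_, ?_⟩
  · refine ⟨fun x j => n x j + if x ∈ A then δ x j else 0, ⟨fun x j => ?_, fun j => ?_⟩, ?_⟩
    · have := hδ x j
      dsimp only
      split_ifs <;> constructor <;> linarith
    · rw [← hA j]
      refine card_le_card fun x hx => ?_
      by_contra hxA
      simp [hxA] at hx
    · rw [sum_add_distrib, sum_ite_mem, inter_eq_right.2 hAq]
  · rintro _ ⟨c, ⟨hc, hcard⟩, rfl⟩
    have hpt : ∀ x ∈ q, c x i ≤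
        n x i + ((if n x i < c x i then d i else 0) + if x ∈ A then δ x i - d i else 0) := by
      intro x hx
      have h1 := (hc x i).2
      by_cases hxA : x ∈ A
      · have h2 := hin i x hxA
        simp only [hxA, if_true]
        split_ifs <;> linarith
      · have h2 := hout i x hx hxA
        simp only [hxA, if_false]
        split_ifs <;> linarith
    have hcard' : ((q.filter fun x => n x i < c x i).card : ℝ) ≤ Γ i := by
      exact_mod_cast (card_le_card (filter_subset_filter _ (subset_univ q))).trans (hcard i)
    have hmul := mul_le_mul_of_nonneg_right hcard' (hd i)
    have hsum := sum_le_sum hpt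
    rw [sum_add_distrib, sum_add_distrib, sum_ite_mem, inter_eq_right.2 hAq, ← sum_filter,
      sum_const, nsmul_eq_mul, sum_sub_distrib, sum_const, nsmul_eq_mul, hA i] at hsum
    linarith

/-- The subproblem objective at `l`, when the elements of `q` with index at most `l` are those of
a set `A` of `Γ i` elements, up to elements whose interval length is `δ̄_{l,i}`. -/
lemma zBSk_apply_eq {E : Type*} [Fintype E] [DecidableEq E] {k : ℕ} {n δ : E → Fin k → ℝ}
    {Γ : Fin k → ℕ} {e : Fin (Fintype.card E) ≃ E} {l : ℕ} {q A : Finset E} {i : Fin k}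
    (hA : A.card = Γ i) (hsub : A ⊆ q.filter fun x => (e.symm x : ℕ) + 1 ≤ l)
    (heq : ∀ x ∈ q, (e.symm x : ℕ) + 1 ≤ l → x ∉ A → δ x i = dbarK δ e l i) :
    zBSk n δ Γ e l q i = ∑ x ∈ q, n x i + ∑ x ∈ A, δ x i := by
  have hsum := sum_subset (f := fun x => δ x i - dbarK δ e l i) hsub fun x hx hxA => by
    rw [mem_filter] at hx
    exact sub_eq_zero.2 (heq x hx.1 hx.2 hxA)
  rw [zBSk, ← hsum, sum_sub_distrib, sum_const, nsmul_eq_mul, hA]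
  ring

/-- Under objective independent element order: if `|q| ≥ Γ_1` and `e_l` (here `l : Fin m`,
1-based index `l+1`) is the element of `q` with the `Γ_1`-th smallest index, then
`zBS^{l+1}(q) = zBS^{l+2}(q) = zRC(q)` as vectors (in 1-based numbering,
`zBS^l(q) = zBS^{l+1}(q) = zRC(q)`). -/
theorem stmt10 {E : Type*} [Fintype E] [DecidableEq E] [Nonempty E] {k : ℕ} (hk : 0 < k)
    (Q : Set (Finset E)) (hQ : Q.Nonempty)
    (n δ : E → Fin k → ℝ) (hδ : ∀ x i, 0 ≤ δ x i)
    (Γ : Fin k → ℕ) (hΓ1 : ∀ i, 1 ≤ Γ i) (hΓ2 : ∀ i, Γ i ≤ Fintype.card E)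
    (hΓeq : ∀ i j, Γ i = Γ j)
    (e : Fin (Fintype.card E) ≃ E)
    (hsort : ∀ i : Fin k, ∀ a b : Fin (Fintype.card E), a ≤ b → δ (e b) i ≤ δ (e a) i)
    (q : Finset E) (hq : q ∈ Q) (hcard : Γ ⟨0, hk⟩ ≤ q.card)
    (l : Fin (Fintype.card E)) (hel : e l ∈ q)
    (hΓl : (Finset.univ.filter fun j : Fin (Fintype.card E) => j ≤ l ∧ e j ∈ q).card
      = Γ ⟨0, hk⟩) :
    zBSk n δ Γ e ((l : ℕ) + 1) q = zRCk n δ Γ q ∧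
    zBSk n δ Γ e ((l : ℕ) + 2) q = zRCk n δ Γ q := by
  have hA : ∀ i, (q.filter fun x => e.symm x ≤ l).card = Γ i := by
    intro i
    rw [hΓeq i ⟨0, hk⟩, ← hΓl]
    refine card_equiv e.symm fun x => ?_
    simp [and_comm]
  have hR := zRCk_apply_eq (n := n) hδ (filter_subset _ q) hA (d := δ (e l)) (hδ (e l))
    (fun i x hx => by
      simpa using hsort i _ _ (mem_filter.1 hx).2)
    (fun i x hx hxA => by
      have hlt : l ≤ e.symm x := by
        by_contra h
        exact hxA (mem_filter.2 ⟨hx, (not_le.1 h).le⟩)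
      simpa using hsort i _ _ hlt)
  constructor
  · ext i
    rw [hR i]
    refine zBSk_apply_eq (hA i) (fun x hx => ?_) fun x hx hxl hxA => ?_
    · rw [mem_filter, Fin.le_def] at hx
      exact mem_filter.2 ⟨hx.1, by omega⟩
    · have hle : e.symm x ≤ l := by
        rw [Fin.le_def]
        omega
      exact absurd (mem_filter.2 ⟨hx, hle⟩) hxA
  · ext i
    rw [hR i]
    refine zBSk_apply_eq (hA i) (fun x hx => ?_) fun x hx hxl hxA => ?_
    · rw [mem_filter, Fin.le_def] at hx
      exact mem_filter.2 ⟨hx.1, by omega⟩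
    · have hgt : ¬ (e.symm x : ℕ) ≤ l := fun h => hxA (mem_filter.2 ⟨hx, Fin.le_def.2 h⟩)
      have hval : (e.symm x : ℕ) = (l : ℕ) + 2 - 1 := by omega
      have hlt : (l : ℕ) + 2 - 1 < Fintype.card E := hval ▸ (e.symm x).isLt
      have hx' : e ⟨(l : ℕ) + 2 - 1, hlt⟩ = x := by
        rw [← e.eq_symm_apply]
        exact Fin.ext hval.symm
      rw [dbarK, dif_pos hlt, hx']
end

section
/- In the general multi-objective setting: (a) for every q ∈ Q, every l ∈ {1, …, m+1}^k and every i ∈ {1, …, k}, zRC_i(q) ≤ zBS^l_i(q); and (b) for every q ∈ Q there exists l = (l_1, …, l_k) ∈ {1, …, m+1}^k with Γ_i ≤ l_i for all i such that zBS^l_i(q) = zRC_i(q) for all i ∈ {1, …, k}. -/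
open Finset

/-- `δ̄^i_l` for `l ∈ {1,…,m}` (1-based), and `δ̄^i_{m+1} = 0`, where for each objective `i`
the enumeration `e i : Fin m ≃ E` lists the elements in order of decreasing `δ_{·,i}`. -/
noncomputable def dbarG {E : Type*} [Fintype E] {k : ℕ} (δ : E → Fin k → ℝ)
    (e : Fin k → (Fin (Fintype.card E) ≃ E)) (i : Fin k) (l : ℕ) : ℝ :=
  if h : l - 1 < Fintype.card E then δ ((e i) ⟨l - 1, h⟩) i else 0

/-- The general multi-objective subproblem objective
`zBS^l_i(q) = ∑_{e∈q} n e i + Γ_i·δ̄^i_{l_i} + ∑_{e ∈ q ∩ E^i_{l_i}} (δ_{e,i} − δ̄^i_{l_i})`,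
where `E^i_{l_i}` consists of the elements whose 1-based index in the `i`-th enumeration
is at most `l_i`. -/
noncomputable def zBSg {E : Type*} [Fintype E] [DecidableEq E] {k : ℕ}
    (n δ : E → Fin k → ℝ) (Γ : Fin k → ℕ) (e : Fin k → (Fin (Fintype.card E) ≃ E))
    (l : Fin k → ℕ) (q : Finset E) : Fin k → ℝ :=
  fun i => (∑ x ∈ q, n x i) + Γ i * dbarG δ e i (l i) +
    ∑ x ∈ q.filter (fun x => (((e i).symm x : ℕ) + 1 ≤ l i)), (δ x i - dbarG δ e i (l i))

theorem card_filter_index_lt_le {E : Type*} {m : ℕ} (σ : E ≃ Fin m) (q : Finset E) (l : ℕ) :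
    (q.filter fun x => (σ x : ℕ) + 1 ≤ l).card ≤ l := by
  calc _ ≤ (range l).card := card_le_card_of_injOn (fun x => (σ x : ℕ))
        (fun x hx => by simpa using (mem_filter.1 hx).2)
        (fun x _ y _ h => σ.injective (Fin.ext h))
    _ = l := card_range l

theorem card_filter_index_lt_succ_le {E : Type*} {m : ℕ} (σ : E ≃ Fin m) (q : Finset E)
    (l : ℕ) :
    (q.filter fun x => (σ x : ℕ) + 1 ≤ l + 1).card ≤
      (q.filter fun x => (σ x : ℕ) + 1 ≤ l).card + 1 := by
  classical
  have hsub : (q.filter fun x => (σ x : ℕ) + 1 ≤ l + 1) ⊆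
      (q.filter fun x => (σ x : ℕ) + 1 ≤ l) ∪ q.filter fun x => (σ x : ℕ) = l := by
    intro x hx
    simp only [mem_union, mem_filter] at hx ⊢
    have : (σ x : ℕ) + 1 ≤ l ∨ (σ x : ℕ) = l := by omega
    tauto
  have hone : (q.filter fun x => (σ x : ℕ) = l).card ≤ 1 := by
    refine card_le_one.2 fun x hx y hy => σ.injective (Fin.ext ?_)
    rw [(mem_filter.1 hx).2, (mem_filter.1 hy).2]
  exact (card_le_card hsub).trans ((card_union_le _ _).trans (Nat.add_le_add_left hone _))

/-- Some threshold `l ≥ g` selects at most `g` elements of `q`, and exactly `g` unless it is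
the last threshold `m + 1`. -/
theorem exists_threshold {E : Type*} {m : ℕ} (σ : E ≃ Fin m) (q : Finset E) {g : ℕ}
    (hg : g ≤ m) :
    ∃ l, g ≤ l ∧ l ≤ m + 1 ∧ (q.filter fun x => (σ x : ℕ) + 1 ≤ l).card ≤ g ∧
      (l = m + 1 ∨ (q.filter fun x => (σ x : ℕ) + 1 ≤ l).card = g) := by
  let P : ℕ → Prop := fun l => (q.filter fun x => (σ x : ℕ) + 1 ≤ l).card ≤ g
  have hgP : P g := card_filter_index_lt_le σ q g
  have hP : P (Nat.findGreatest P (m + 1)) := Nat.findGreatest_spec (by omega) hgP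
  have hle := Nat.findGreatest_le (P := P) (m + 1)
  refine ⟨_, Nat.le_findGreatest (by omega) hgP, hle, hP, ?_⟩
  rcases hle.eq_or_lt with h | h
  · exact Or.inl h
  · right
    have hnot : ¬ P (Nat.findGreatest P (m + 1) + 1) :=
      Nat.findGreatest_is_greatest (Nat.lt_succ_self _) h
    have hstep := card_filter_index_lt_succ_le σ q (Nat.findGreatest P (m + 1))
    simp only [P, not_le] at hP hnot hstep ⊢
    omega

section ZBS

variable {E : Type*} [Fintype E] {k : ℕ} {n δ : E → Fin k → ℝ} {Γ : Fin k → ℕ}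
  {e : Fin k → (Fin (Fintype.card E) ≃ E)}

theorem dbarG_nonneg (hδ : ∀ x i, 0 ≤ δ x i) (i : Fin k) (l : ℕ) : 0 ≤ dbarG δ e i l := by
  unfold dbarG
  split_ifs
  exacts [hδ _ _, le_rfl]

theorem dbarG_le_of_index_lt (hδ : ∀ x i, 0 ≤ δ x i)
    (hsort : ∀ i, ∀ a b : Fin (Fintype.card E), a ≤ b → δ ((e i) b) i ≤ δ ((e i) a) i)
    {i : Fin k} {l : ℕ} {x : E} (hx : ((e i).symm x : ℕ) + 1 ≤ l) :
    dbarG δ e i l ≤ δ x i := by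
  unfold dbarG
  split_ifs with h
  · simpa using hsort i ((e i).symm x) ⟨l - 1, h⟩ (Fin.le_def.2 (by simp only; omega))
  · exact hδ x i

theorem le_dbarG_of_le_index
    (hsort : ∀ i, ∀ a b : Fin (Fintype.card E), a ≤ b → δ ((e i) b) i ≤ δ ((e i) a) i)
    {i : Fin k} {l : ℕ} {x : E} (hx : ¬ ((e i).symm x : ℕ) + 1 ≤ l) :
    δ x i ≤ dbarG δ e i l := by
  have hlt := ((e i).symm x).isLt
  have h : l - 1 < Fintype.card E := by omega
  rw [dbarG, dif_pos h]
  simpa using hsort i ⟨l - 1, h⟩ ((e i).symm x) (Fin.le_def.2 (by simp only; omega))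

variable [DecidableEq E]

theorem sum_le_zBSg (hδ : ∀ x i, 0 ≤ δ x i)
    (hsort : ∀ i, ∀ a b : Fin (Fintype.card E), a ≤ b → δ ((e i) b) i ≤ δ ((e i) a) i)
    {c : E → Fin k → ℝ} (hc : c ∈ Uk n δ Γ) (l : Fin k → ℕ) (q : Finset E) (i : Fin k) :
    ∑ x ∈ q, c x i ≤ zBSg n δ Γ e l q i := by
  obtain ⟨hbd, hcard⟩ := hc
  set D := dbarG δ e i (l i)
  have hD : 0 ≤ D := dbarG_nonneg hδ i (l i)
  have hpoint : ∀ x ∈ q, c x i ≤ n x i + (if n x i < c x i then D else 0) +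
      (if ((e i).symm x : ℕ) + 1 ≤ l i then δ x i - D else 0) := by
    intro x _
    have hx := (hbd x i).2
    split_ifs with h1 h2 h2
    · linarith
    · linarith [le_dbarG_of_le_index hsort h2]
    · linarith [dbarG_le_of_index_lt hδ hsort h2]
    · linarith
  have hdev : ∑ x ∈ q, (if n x i < c x i then D else 0) ≤ Γ i * D := by
    rw [← sum_filter, sum_const, nsmul_eq_mul]
    refine mul_le_mul_of_nonneg_right (Nat.cast_le.2 ?_) hD
    exact (card_le_card (filter_subset_filter _ (subset_univ q))).trans (hcard i)
  have hsum := sum_le_sum hpoint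
  rw [sum_add_distrib, sum_add_distrib, ← sum_filter (fun x => ((e i).symm x : ℕ) + 1 ≤ l i)]
    at hsum
  unfold zBSg
  linarith

theorem nominal_mem_Uk (hδ : ∀ x i, 0 ≤ δ x i) : n ∈ Uk n δ Γ :=
  ⟨fun x i => ⟨le_rfl, le_add_of_nonneg_right (hδ x i)⟩, fun i => by simp⟩

theorem zRCk_le_zBSg (hδ : ∀ x i, 0 ≤ δ x i)
    (hsort : ∀ i, ∀ a b : Fin (Fintype.card E), a ≤ b → δ ((e i) b) i ≤ δ ((e i) a) i)
    (l : Fin k → ℕ) (q : Finset E) (i : Fin k) :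
    zRCk n δ Γ q i ≤ zBSg n δ Γ e l q i := by
  refine csSup_le ⟨_, n, nominal_mem_Uk hδ, rfl⟩ ?_
  rintro _ ⟨c, hc, rfl⟩
  exact sum_le_zBSg hδ hsort hc l q i

theorem sum_le_zRCk {c : E → Fin k → ℝ} (hc : c ∈ Uk n δ Γ) (q : Finset E) (i : Fin k) :
    ∑ x ∈ q, c x i ≤ zRCk n δ Γ q i := by
  refine le_csSup ⟨∑ x ∈ q, (n x i + δ x i), ?_⟩ ⟨c, hc, rfl⟩
  rintro _ ⟨c', hc', rfl⟩
  exact sum_le_sum fun x _ => (hc'.1 x i).2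

theorem sum_add_sum_le_zRCk (hδ : ∀ x i, 0 ≤ δ x i) {q : Finset E} {T : Fin k → Finset E}
    (hTq : ∀ i, T i ⊆ q) (hT : ∀ i, (T i).card ≤ Γ i) (i : Fin k) :
    ∑ x ∈ q, n x i + ∑ x ∈ T i, δ x i ≤ zRCk n δ Γ q i := by
  have hc : (fun x j => n x j + if x ∈ T j then δ x j else 0) ∈ Uk n δ Γ := by
    refine ⟨fun x j => ?_, fun j => (card_le_card fun x hx => ?_).trans (hT j)⟩
    · have := hδ x j
      dsimp only
      split_ifs <;> constructor <;> linarith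
    · by_contra hxT
      simp [hxT] at hx
  have h := sum_le_zRCk hc q i
  rwa [sum_add_distrib, sum_ite_mem, inter_eq_right.2 (hTq i)] at h

theorem zBSg_eq_of_threshold {l : Fin k → ℕ} {q : Finset E} {i : Fin k}
    (h : l i = Fintype.card E + 1 ∨
      (q.filter fun x => ((e i).symm x : ℕ) + 1 ≤ l i).card = Γ i) :
    zBSg n δ Γ e l q i =
      ∑ x ∈ q, n x i + ∑ x ∈ q.filter (fun x => ((e i).symm x : ℕ) + 1 ≤ l i), δ x i := by
  rw [zBSg, sum_sub_distrib, sum_const, nsmul_eq_mul]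
  rcases h with h | h
  · have hD : dbarG δ e i (l i) = 0 := by simp [dbarG, h]
    rw [hD]
    ring
  · rw [h]
    ring

end ZBS

/-- In the general multi-objective setting: (a) `zRC_i(q) ≤ zBS^l_i(q)` for every `q ∈ Q`,
every `l ∈ {1,…,m+1}^k` and every `i`; (b) for every `q ∈ Q` there is
`l ∈ {1,…,m+1}^k` with `Γ_i ≤ l_i` for all `i` and `zBS^l_i(q) = zRC_i(q)` for all `i`. -/
theorem stmt12 {E : Type*} [Fintype E] [DecidableEq E] [Nonempty E] {k : ℕ} (hk : 0 < k)
    (Q : Set (Finset E)) (hQ : Q.Nonempty)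
    (n δ : E → Fin k → ℝ) (hδ : ∀ x i, 0 ≤ δ x i)
    (Γ : Fin k → ℕ) (hΓ1 : ∀ i, 1 ≤ Γ i) (hΓ2 : ∀ i, Γ i ≤ Fintype.card E)
    (e : Fin k → (Fin (Fintype.card E) ≃ E))
    (hsort : ∀ i : Fin k, ∀ a b : Fin (Fintype.card E), a ≤ b → δ ((e i) b) i ≤ δ ((e i) a) i) :
    (∀ q ∈ Q, ∀ l : Fin k → ℕ, (∀ i, 1 ≤ l i ∧ l i ≤ Fintype.card E + 1) →
      ∀ i, zRCk n δ Γ q i ≤ zBSg n δ Γ e l q i) ∧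
    (∀ q ∈ Q, ∃ l : Fin k → ℕ, (∀ i, Γ i ≤ l i ∧ l i ≤ Fintype.card E + 1) ∧
      ∀ i, zBSg n δ Γ e l q i = zRCk n δ Γ q i) := by
  refine ⟨fun q _ l _ i => zRCk_le_zBSg hδ hsort l q i, fun q _ => ?_⟩
  choose l hΓl hlm hcard hl using fun i => exists_threshold (e i).symm q (hΓ2 i)
  refine ⟨l, fun i => ⟨hΓl i, hlm i⟩, fun i => le_antisymm ?_ (zRCk_le_zBSg hδ hsort l q i)⟩
  rw [zBSg_eq_of_threshold (hl i)]
  exact sum_add_sum_le_zRCk hδ (fun j => filter_subset _ q) hcard i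
end

section
/- In the general multi-objective setting, let l̃, l ∈ {1, …, m+1}^k with l̃_i ≤ l_i for all i, let I = {i : l̃_i < l_i}, and let Z̃ ⊆ Q be a complete set of efficient solutions for the multi-objective problem min_{q∈Q} zBS^{l̃}(q). If no member of Z̃ contains any element of ∪_{i ∈ I} E^i_{l_i}, then Z̃ is a complete set of efficient solutions for min_{q∈Q} zBS^l(q). -/
open Finset

/-- `y` dominates `y'` if `y_j ≤ y'_j` for all `j` and `y ≠ y'`. -/
def Dominates {ι : Type*} (y y' : ι → ℝ) : Prop := (∀ j, y j ≤ y' j) ∧ y ≠ y'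

/-- `q` is an efficient solution of `min_{q ∈ Q} f(q)`:
`q ∈ Q` and no `q' ∈ Q` has `f q'` dominating `f q`. -/
def Efficient {E ι : Type*} (Q : Set (Finset E)) (f : Finset E → ι → ℝ)
    (q : Finset E) : Prop :=
  q ∈ Q ∧ ∀ q' ∈ Q, ¬ Dominates (f q') (f q)

/-- `G` is a complete set of efficient solutions for `f` on `Q`: `G ⊆ Q`, every member of `G`
is efficient, and every `q ∈ Q` is dominated by, or has the same `f`-value as, a member of `G`. -/
def CompleteEff {E ι : Type*} (Q : Set (Finset E)) (f : Finset E → ι → ℝ)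
    (G : Set (Finset E)) : Prop :=
  G ⊆ Q ∧ (∀ q ∈ G, Efficient Q f q) ∧
    ∀ q ∈ Q, ∃ q' ∈ G, Dominates (f q') (f q) ∨ f q' = f q

/-- If `g` dominates a translate of `f` on `Q` and agrees with it on a complete set of efficient
solutions for `f`, then that set is also a complete set of efficient solutions for `g`. -/
theorem CompleteEff.of_add_le {E ι : Type*} {Q : Set (Finset E)} {f g : Finset E → ι → ℝ}
    {G : Set (Finset E)} (hG : CompleteEff Q f G) (D : ι → ℝ)
    (hle : ∀ q ∈ Q, ∀ i, f q i + D i ≤ g q i) (heq : ∀ q ∈ G, ∀ i, g q i = f q i + D i) :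
    CompleteEff Q g G := by
  obtain ⟨hsub, heff, hcomp⟩ := hG
  refine ⟨hsub, fun q hq => ⟨hsub hq, fun q' hq' hdom => ?_⟩, fun q hq => ?_⟩
  · have hf : ∀ i, f q' i ≤ f q i := fun i => by
      linarith [hle q' hq' i, hdom.1 i, heq q hq i]
    have hfe : f q' = f q := by
      by_contra hne
      exact (heff q hq).2 q' hq' ⟨hf, hne⟩
    refine hdom.2 (funext fun i => le_antisymm (hdom.1 i) ?_)
    rw [heq q hq i, ← hfe]
    exact hle q' hq' i
  · obtain ⟨q', hq', h⟩ := hcomp q hq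
    have hf : ∀ i, f q' i ≤ f q i := by
      rcases h with h | h
      · exact h.1
      · exact fun i => (congrFun h i).le
    have hg : ∀ i, g q' i ≤ g q i := fun i => by
      linarith [hle q hq i, hf i, heq q' hq' i]
    by_cases he : g q' = g q
    · exact ⟨q', hq', Or.inr he⟩
    · exact ⟨q', hq', Or.inl ⟨hg, he⟩⟩

section

variable {E : Type*} [Fintype E] {k : ℕ} {δ : E → Fin k → ℝ}
  {e : Fin k → (Fin (Fintype.card E) ≃ E)} {i : Fin k}

theorem dbarG_anti (hδ : ∀ x i, 0 ≤ δ x i)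
    (hsort : ∀ a b : Fin (Fintype.card E), a ≤ b → δ ((e i) b) i ≤ δ ((e i) a) i)
    {a b : ℕ} (hab : a ≤ b) : dbarG δ e i b ≤ dbarG δ e i a := by
  unfold dbarG
  split_ifs with h₁ h₂ h₂
  · exact hsort _ _ (Fin.mk_le_mk.2 (by omega))
  · omega
  · exact hδ _ _
  · exact le_rfl

theorem dbarG_le (hδ : ∀ x i, 0 ≤ δ x i)
    (hsort : ∀ a b : Fin (Fintype.card E), a ≤ b → δ ((e i) b) i ≤ δ ((e i) a) i)
    {l : ℕ} {x : E} (hx : ((e i).symm x : ℕ) + 1 ≤ l) : dbarG δ e i l ≤ δ x i := by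
  unfold dbarG
  split_ifs with h
  · simpa using hsort ((e i).symm x) ⟨l - 1, h⟩ (Fin.le_def.2 (by simp only; omega))
  · exact hδ _ _

theorem sum_sub_dbarG_mono (hδ : ∀ x i, 0 ≤ δ x i)
    (hsort : ∀ a b : Fin (Fintype.card E), a ≤ b → δ ((e i) b) i ≤ δ ((e i) a) i)
    {a b : ℕ} (hab : a ≤ b) (q : Finset E) :
    ∑ x ∈ q.filter (fun x => ((e i).symm x : ℕ) + 1 ≤ a), (δ x i - dbarG δ e i a) ≤
      ∑ x ∈ q.filter (fun x => ((e i).symm x : ℕ) + 1 ≤ b), (δ x i - dbarG δ e i b) :=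
  calc
    _ ≤ ∑ x ∈ q.filter (fun x => ((e i).symm x : ℕ) + 1 ≤ a), (δ x i - dbarG δ e i b) :=
      Finset.sum_le_sum fun _ _ => sub_le_sub_left (dbarG_anti hδ hsort hab) _
    _ ≤ _ := Finset.sum_le_sum_of_subset_of_nonneg
      (Finset.monotone_filter_right q fun _ _ hx => le_trans hx hab)
      fun _ hx _ => sub_nonneg.2 (dbarG_le hδ hsort (Finset.mem_filter.1 hx).2)

end

/-- In the general multi-objective setting: let `l̃, l ∈ {1,…,m+1}^k` with `l̃_i ≤ l_i` for
all `i`, and let `Z̃` be a complete set of efficient solutions for `min_{q∈Q} zBS^{l̃}(q)`.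
If no member of `Z̃` contains an element of `E^i_{l_i}` for any `i` with `l̃_i < l_i`,
then `Z̃` is a complete set of efficient solutions for `min_{q∈Q} zBS^l(q)`. -/
theorem stmt14 {E : Type*} [Fintype E] [DecidableEq E] [Nonempty E] {k : ℕ} (hk : 0 < k)
    (Q : Set (Finset E)) (hQ : Q.Nonempty)
    (n δ : E → Fin k → ℝ) (hδ : ∀ x i, 0 ≤ δ x i)
    (Γ : Fin k → ℕ) (hΓ1 : ∀ i, 1 ≤ Γ i) (hΓ2 : ∀ i, Γ i ≤ Fintype.card E)
    (e : Fin k → (Fin (Fintype.card E) ≃ E))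
    (hsort : ∀ i : Fin k, ∀ a b : Fin (Fintype.card E), a ≤ b → δ ((e i) b) i ≤ δ ((e i) a) i)
    (lt l : Fin k → ℕ)
    (hlt : ∀ i, 1 ≤ lt i ∧ lt i ≤ Fintype.card E + 1)
    (hl : ∀ i, 1 ≤ l i ∧ l i ≤ Fintype.card E + 1)
    (hle : ∀ i, lt i ≤ l i)
    (Zt : Set (Finset E)) (hZt : CompleteEff Q (zBSg n δ Γ e lt) Zt)
    (hnone : ∀ q ∈ Zt, ∀ i : Fin k, lt i < l i →
      ∀ x ∈ q, ¬ (((e i).symm x : ℕ) + 1 ≤ l i)) :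
    CompleteEff Q (zBSg n δ Γ e l) Zt := by
  refine hZt.of_add_le (fun i => Γ i * dbarG δ e i (l i) - Γ i * dbarG δ e i (lt i))
    (fun q _ i => ?_) (fun q hq i => ?_)
  · have := sum_sub_dbarG_mono hδ (hsort i) (hle i) q
    simp only [zBSg]
    linarith
  · rcases (hle i).eq_or_lt with h | h
    · simp only [zBSg, h]
      ring
    · have hl' := hnone q hq i h
      have hlt' : ∀ x ∈ q, ¬ (((e i).symm x : ℕ) + 1 ≤ lt i) :=
        fun x hx hx' => hl' x hx (hx'.trans h.le)
      simp only [zBSg, Finset.filter_false_of_mem hl', Finset.filter_false_of_mem hlt',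
        Finset.sum_empty]
      ring
end

section
/- Every q* ∈ Q that minimizes the worst-case cost zRC over Q is an efficient solution of the deterministic multi-objective problem min_{q∈Q} g(q), where g(q) = (Σ_{e∈q} n_e, kmax_1(q), kmax_2(q), …, kmax_Γ(q)) ∈ ℝ^{Γ+1}; that is, there is no q′ ∈ Q such that g(q′) dominates g(q*). -/
open Finset

/-- The bottleneck objective vector
`g(q) = (∑_{e∈q} n e, kmax_1(q), …, kmax_Γ(q)) ∈ ℝ^{Γ+1}`,
indexed by `Fin (Γ+1)`: component `0` is the nominal sum, component `j ≥ 1` is `kmax_j(q)`. -/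
noncomputable def gLA {E : Type*} (n δ : E → ℝ) (Γ : ℕ) (q : Finset E) :
    Fin (Γ + 1) → ℝ :=
  fun j => if (j : ℕ) = 0 then ∑ x ∈ q, n x else kmax δ (j : ℕ) q

lemma List.sum_take_eq_sum_range_getD (L : List ℝ) (k : ℕ) :
    (L.take k).sum = ∑ i ∈ Finset.range k, L.getD i 0 := by
  induction k generalizing L with
  | zero => simp
  | succ k ih =>
    cases L with
    | nil => simp
    | cons a L => rw [Finset.sum_range_succ', List.take_succ_cons, List.sum_cons, ih, add_comm]; simp

/-- The sum of a sublist of length at most `k` of a decreasing list of nonnegative reals is at most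
the sum of the first `k` entries. -/
lemma List.Sublist.sum_le_sum_take_s15 {l L : List ℝ} (h : l.Sublist L) (hs : L.Pairwise (· ≥ ·))
    (h0 : ∀ x ∈ L, 0 ≤ x) (k : ℕ) (hk : l.length ≤ k) : l.sum ≤ (L.take k).sum := by
  induction h generalizing k with
  | slnil => simp
  | @cons l L a h ih =>
    rw [List.pairwise_cons] at hs
    have hL : ∀ x ∈ L, 0 ≤ x := fun x hx => h0 x (List.mem_cons_of_mem _ hx)
    have ha : 0 ≤ a := h0 a List.mem_cons_self
    refine (ih hs.2 hL k hk).trans ?_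
    cases k with
    | zero => simp
    | succ k =>
      have hget : L.getD k 0 ≤ a := by
        rcases lt_or_ge k L.length with h | h
        · rw [List.getD_eq_getElem _ _ h]; exact hs.1 _ (List.getElem_mem h)
        · rw [List.getD_eq_default _ _ h]; exact ha
      rw [List.take_succ_cons, List.sum_cons, List.sum_take_eq_sum_range_getD,
        List.sum_take_eq_sum_range_getD, Finset.sum_range_succ]
      linarith
  | @cons_cons l L a h ih =>
    rw [List.pairwise_cons] at hs
    cases k with
    | zero => simp at hk
    | succ k =>
      have := ih hs.2 (fun x hx => h0 x (List.mem_cons_of_mem _ hx)) k (by simpa using hk)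
      simpa using this

/-- The elements of a finite set can be listed by decreasing value of `δ`. -/
lemma exists_list_map_eq_sort {E : Type*} (δ : E → ℝ) (q : Finset E) :
    ∃ l : List E, (l : Multiset E) = q.val ∧ l.map δ = (q.val.map δ).sort (· ≥ ·) := by
  have h : (((q.val.map δ).sort (· ≥ ·) : List ℝ) : Multiset ℝ) = (q.toList.map δ : List ℝ) := by
    rw [Multiset.sort_eq, ← Multiset.map_coe, Finset.coe_toList]
  obtain ⟨l, hl, hmap⟩ : ∃ l : List E, l.Perm q.toList ∧
      l.map δ = (q.val.map δ).sort (· ≥ ·) := by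
    have hp := Multiset.coe_eq_coe.1 h
    have : Relation.Comp List.Perm (List.Forall₂ fun b a => b = δ a)
        ((q.val.map δ).sort (· ≥ ·)) q.toList :=
      ⟨_, hp, by simp [List.forall₂_map_left_iff, List.forall₂_same]⟩
    rw [← List.forall₂_comp_perm_eq_perm_comp_forall₂] at this
    obtain ⟨l, hl, hperm⟩ := this
    refine ⟨l, hperm, ?_⟩
    rw [← List.forall₂_eq_eq_eq, List.forall₂_map_left_iff]
    exact hl.flip.imp fun _ _ h => h.symm
  exact ⟨l, by rw [Multiset.coe_eq_coe.2 hl, Finset.coe_toList], hmap⟩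

/-- The worst-case cost is the sum of the components of the bottleneck objective vector. -/
lemma zRC_eq_sum_gLA {E : Type*} [Fintype E] [DecidableEq E] (n δ : E → ℝ) (hδ : ∀ x, 0 ≤ δ x)
    (Γ : ℕ) (q : Finset E) : zRC n δ Γ q = ∑ j, gLA n δ Γ q j := by
  obtain ⟨l, hl, hmap⟩ := exists_list_map_eq_sort δ q
  have hnd : l.Nodup := by
    rw [← Multiset.coe_nodup, hl]; exact q.nodup
  have hmem : ∀ e, e ∈ l ↔ e ∈ q := fun e => by
    rw [← Multiset.mem_coe, hl, Finset.mem_val]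
  have hg : ∑ j, gLA n δ Γ q j = ∑ e ∈ q, n e + ((l.map δ).take Γ).sum := by
    rw [Fin.sum_univ_succ, List.sum_take_eq_sum_range_getD, ← Fin.sum_univ_eq_sum_range, hmap]
    simp [gLA, kmax]
  rw [hg]
  refine IsGreatest.csSup_eq ⟨?_, ?_⟩
  · set T := (l.take Γ).toFinset with hT
    have hTq : T ⊆ q := fun e he => (hmem e).1 (List.mem_of_mem_take (List.mem_toFinset.1 he))
    refine ⟨fun e => n e + if e ∈ T then δ e else 0, ⟨fun e => ?_, ?_⟩, ?_⟩
    · have := hδ e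
      dsimp only
      split_ifs <;> constructor <;> linarith
    · refine (Finset.card_le_card (t := T) fun e he => ?_).trans
        ((List.toFinset_card_le _).trans (List.length_take_le _ _))
      by_contra h
      simp [h] at he
    · rw [Finset.sum_add_distrib, Finset.sum_ite_mem, Finset.inter_eq_right.2 hTq, hT,
        List.sum_toFinset _ (hnd.sublist (List.take_sublist _ _)), List.map_take]
  · rintro x ⟨c, ⟨hc, hcard⟩, rfl⟩
    have hfilter : ∑ e ∈ q with n e < c e, δ e =
        ((l.filter fun e => n e < c e).map δ).sum := by
      rw [← List.sum_toFinset _ (hnd.filter _)]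
      congr 1
      ext e
      simp [hmem]
    have hlen : ((l.filter fun e => n e < c e).map δ).length ≤ Γ := by
      rw [List.length_map, ← List.toFinset_card_of_nodup (hnd.filter _)]
      refine (Finset.card_le_card fun e he => ?_).trans hcard
      simp only [List.mem_toFinset, List.mem_filter, decide_eq_true_eq] at he
      simpa using he.2
    have hsum := (List.filter_sublist.map δ).sum_le_sum_take_s15
      (hmap ▸ Multiset.pairwise_sort _ _) (by simp [hδ]) Γ hlen
    rw [← hfilter, Finset.sum_filter] at hsum
    calc ∑ e ∈ q, c e ≤ ∑ e ∈ q, (n e + if n e < c e then δ e else 0) := by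
          refine Finset.sum_le_sum fun e _ => ?_
          have := hc e
          split_ifs <;> linarith
      _ ≤ _ := by rw [Finset.sum_add_distrib]; gcongr

/-- Every `q* ∈ Q` minimizing the worst-case cost `zRC` over `Q` is an efficient solution of
the deterministic multi-objective problem `min_{q∈Q} g(q)` with
`g(q) = (∑_{e∈q} n e, kmax_1(q), …, kmax_Γ(q))`. -/
theorem stmt15 {E : Type*} [Fintype E] [DecidableEq E] [Nonempty E]
    (Q : Set (Finset E)) (hQ : Q.Nonempty)
    (n δ : E → ℝ) (hδ : ∀ x, 0 ≤ δ x)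
    (Γ : ℕ) (hΓ1 : 1 ≤ Γ) (hΓ2 : Γ ≤ Fintype.card E)
    (qstar : Finset E) (hmem : qstar ∈ Q)
    (hopt : ∀ q ∈ Q, zRC n δ Γ qstar ≤ zRC n δ Γ q) :
    Efficient Q (gLA n δ Γ) qstar := by
  refine ⟨hmem, fun q' hq' ⟨hle, hne⟩ => (hopt q' hq').not_gt ?_⟩
  rw [zRC_eq_sum_gLA n δ hδ, zRC_eq_sum_gLA n δ hδ]
  obtain ⟨j, hj⟩ := Function.ne_iff.1 hne
  exact Finset.sum_lt_sum (fun j _ => hle j) ⟨j, Finset.mem_univ j, (hle j).lt_of_ne hj⟩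
end

section
/- Let g(q) = (Σ_{e∈q} n_e, kmax_1(q), kmax_2(q), …, kmax_Γ(q)) ∈ ℝ^{Γ+1}. If Q′ ⊆ Q is a complete set of efficient solutions for g (every member of Q′ is efficient for g, and every q ∈ Q is either dominated with respect to g by, or has the same g-value as, some member of Q′), then Q′ contains a solution q′ with zRC(q′) = min_{q∈Q} zRC(q), i.e., a minmax robust optimal solution. -/
open Finset

theorem List.Sublist.sum_le_sum_range_getD {s l : List ℝ} (h : s.Sublist l)
    (hl : l.Pairwise (· ≥ ·)) (h0 : ∀ x ∈ l, 0 ≤ x) {k : ℕ} (hk : s.length ≤ k) :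
    s.sum ≤ ∑ i ∈ Finset.range k, l.getD i 0 := by
  induction h generalizing k with
  | slnil => simp
  | @cons s l a h ih =>
    rw [List.pairwise_cons] at hl
    have h0' : ∀ x ∈ l, 0 ≤ x := fun x hx => h0 x (List.mem_cons_of_mem _ hx)
    cases k with
    | zero =>
      obtain rfl : s = [] := List.length_eq_zero_iff.mp (Nat.le_zero.mp hk)
      simp
    | succ k =>
      have hs := ih hl.2 h0' hk
      have ha : l.getD k 0 ≤ a := by
        by_cases hkl : k < l.length
        · rw [List.getD_eq_getElem _ _ hkl]
          exact hl.1 _ (List.getElem_mem hkl)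
        · rw [List.getD_eq_default _ _ (not_lt.mp hkl)]
          exact h0 a List.mem_cons_self
      rw [Finset.sum_range_succ] at hs
      rw [Finset.sum_range_succ']
      simp only [List.getD_cons_succ, List.getD_cons_zero]
      linarith
  | @cons_cons s l a h ih =>
    rw [List.pairwise_cons] at hl
    have h0' : ∀ x ∈ l, 0 ≤ x := fun x hx => h0 x (List.mem_cons_of_mem _ hx)
    cases k with
    | zero => simp at hk
    | succ k =>
      have hs := ih hl.2 h0' (Nat.le_of_succ_le_succ hk)
      rw [Finset.sum_range_succ']
      simp only [List.getD_cons_succ, List.getD_cons_zero, List.sum_cons]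
      linarith

theorem List.sum_range_getD_eq_sum_take (l : List ℝ) (k : ℕ) :
    ∑ i ∈ Finset.range k, l.getD i 0 = (l.take k).sum := by
  induction l generalizing k with
  | nil => simp
  | cons a l ih =>
    cases k with
    | zero => simp
    | succ k =>
      rw [Finset.sum_range_succ']
      simp only [List.getD_cons_succ, List.getD_cons_zero, List.take_succ_cons, List.sum_cons, ih]
      ring

theorem Multiset.exists_le_map_eq_of_le_map {α β : Type*} {f : α → β} {s : Multiset α}
    {t : Multiset β} (h : t ≤ s.map f) : ∃ u ≤ s, u.map f = t := by
  induction s using Quotient.inductionOn with | _ l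
  induction t using Quotient.inductionOn with | _ l'
  obtain ⟨l'', hperm, hsub⟩ := Multiset.coe_le.mp h
  obtain ⟨x, hx, rfl⟩ := List.sublist_map_iff.mp hsub
  exact ⟨x, Multiset.coe_le.mpr hx.subperm, Quotient.sound hperm⟩

theorem sum_le_sum_kmax {E : Type*} {δ : E → ℝ} (hδ : ∀ x, 0 ≤ δ x) {Γ : ℕ} {S q : Finset E}
    (hS : S ⊆ q) (hcard : S.card ≤ Γ) :
    ∑ e ∈ S, δ e ≤ ∑ i ∈ range Γ, kmax δ (i + 1) q := by
  have hle : S.val.map δ ≤ q.val.map δ := Multiset.map_le_map (Finset.val_le_iff.mpr hS)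
  rw [← Multiset.sort_eq (S.val.map δ) (· ≥ ·), ← Multiset.sort_eq (q.val.map δ) (· ≥ ·),
    Multiset.coe_le] at hle
  obtain ⟨l, hperm, hsub⟩ := hle
  have hl : (l : Multiset ℝ) = S.val.map δ :=
    (Multiset.coe_eq_coe.mpr hperm).trans (Multiset.sort_eq _ _)
  have hsum : ∑ e ∈ S, δ e = l.sum := by
    rw [← Multiset.sum_coe, hl]
    rfl
  have hlen : l.length = S.card := by
    rw [← Multiset.coe_card, hl, Multiset.card_map, Finset.card_val]
  rw [hsum]
  refine hsub.sum_le_sum_range_getD (Multiset.pairwise_sort _ _) ?_ (hlen ▸ hcard)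
  intro x hx
  rw [Multiset.mem_sort, Multiset.mem_map] at hx
  obtain ⟨e, -, rfl⟩ := hx
  exact hδ e

theorem exists_sum_eq_sum_kmax {E : Type*} (δ : E → ℝ) (Γ : ℕ) (q : Finset E) :
    ∃ S ⊆ q, S.card ≤ Γ ∧ ∑ e ∈ S, δ e = ∑ i ∈ range Γ, kmax δ (i + 1) q := by
  set l := (q.val.map δ).sort (· ≥ ·) with hl
  have hle : ((l.take Γ : List ℝ) : Multiset ℝ) ≤ q.val.map δ := by
    conv_rhs => rw [← Multiset.sort_eq (q.val.map δ) (· ≥ ·)]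
    exact Multiset.coe_le.mpr (List.take_sublist _ _).subperm
  obtain ⟨u, hu, hmap⟩ := Multiset.exists_le_map_eq_of_le_map hle
  refine ⟨⟨u, Multiset.nodup_of_le hu q.nodup⟩, Finset.val_le_iff.mp hu, ?_, ?_⟩
  · rw [Finset.card_mk, ← Multiset.card_map δ, hmap, Multiset.coe_card]
    exact List.length_take_le _ _
  · calc (u.map δ).sum = (l.take Γ).sum := by rw [hmap, Multiset.sum_coe]
      _ = _ := (List.sum_range_getD_eq_sum_take l Γ).symm

theorem zRC_eq_sum_add_sum_kmax {E : Type*} [Fintype E] [DecidableEq E] (n : E → ℝ) {δ : E → ℝ}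
    (hδ : ∀ x, 0 ≤ δ x) (Γ : ℕ) (q : Finset E) :
    zRC n δ Γ q = ∑ e ∈ q, n e + ∑ i ∈ range Γ, kmax δ (i + 1) q := by
  refine IsGreatest.csSup_eq ⟨?_, ?_⟩
  · obtain ⟨S, hSq, hcard, hsum⟩ := exists_sum_eq_sum_kmax δ Γ q
    refine ⟨fun e => n e + if e ∈ S then δ e else 0, ⟨fun e => ?_, ?_⟩, ?_⟩
    · have := hδ e
      dsimp only
      split_ifs <;> constructor <;> linarith
    · refine (Finset.card_le_card fun e he => ?_).trans hcard
      by_contra he'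
      simp [he'] at he
    · rw [Finset.sum_add_distrib, Finset.sum_ite_mem, Finset.inter_eq_right.mpr hSq, hsum]
  · rintro _ ⟨c, ⟨hc, hcard⟩, rfl⟩
    have hS : (q.filter fun e => n e < c e).card ≤ Γ :=
      (Finset.card_le_card (Finset.filter_subset_filter _ (Finset.subset_univ q))).trans hcard
    have hk := sum_le_sum_kmax hδ (Finset.filter_subset (fun e => n e < c e) q) hS
    rw [Finset.sum_filter] at hk
    refine le_trans ?_ (add_le_add_right hk _)
    rw [← Finset.sum_add_distrib]
    refine Finset.sum_le_sum fun e _ => ?_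
    split_ifs with h
    · exact (hc e).2
    · linarith

theorem zRC_le_of_gLA_le {E : Type*} [Fintype E] [DecidableEq E] {n δ : E → ℝ}
    (hδ : ∀ x, 0 ≤ δ x) {Γ : ℕ} {q q' : Finset E} (h : gLA n δ Γ q ≤ gLA n δ Γ q') :
    zRC n δ Γ q ≤ zRC n δ Γ q' := by
  rw [zRC_eq_sum_add_sum_kmax n hδ, zRC_eq_sum_add_sum_kmax n hδ]
  refine add_le_add (by simpa [gLA] using h 0) (Finset.sum_le_sum fun i hi => ?_)
  simpa [gLA] using h ⟨i + 1, Nat.succ_lt_succ (Finset.mem_range.mp hi)⟩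

/-- If `Q' ⊆ Q` is a complete set of efficient solutions for
`g(q) = (∑_{e∈q} n e, kmax_1(q), …, kmax_Γ(q))`, then `Q'` contains a minmax robust optimal
solution, i.e. some `q' ∈ Q'` with `zRC(q') = min_{q∈Q} zRC(q)`. -/
theorem stmt16 {E : Type*} [Fintype E] [DecidableEq E] [Nonempty E]
    (Q : Set (Finset E)) (hQ : Q.Nonempty)
    (n δ : E → ℝ) (hδ : ∀ x, 0 ≤ δ x)
    (Γ : ℕ) (hΓ1 : 1 ≤ Γ) (hΓ2 : Γ ≤ Fintype.card E)
    (Q' : Set (Finset E)) (hQ' : CompleteEff Q (gLA n δ Γ) Q') :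
    ∃ q' ∈ Q', ∀ q ∈ Q, zRC n δ Γ q' ≤ zRC n δ Γ q := by
  obtain ⟨q₀, hq₀, hmin⟩ := Q.toFinite.exists_minimalFor (zRC n δ Γ) Q hQ
  obtain ⟨q', hq', h⟩ := hQ'.2.2 q₀ hq₀
  have hle : gLA n δ Γ q' ≤ gLA n δ Γ q₀ := h.elim (fun h => h.1) le_of_eq
  refine ⟨q', hq', fun q hq => (zRC_le_of_gLA_le hδ hle).trans ?_⟩
  exact (le_total _ _).elim id fun hqq => hmin hq hqq
end

section
/- If Q′ ⊆ Q is a complete set of efficient solutions for the deterministic multi-objective problem min_{q∈Q} zLA(q), then for every efficient solution q of the robust counterpart min_{q∈Q} zRC(q) there exists q′ ∈ Q′ with zRC(q′) = zRC(q); consequently, Q′ contains a complete set of robust efficient solutions, namely the members of Q′ that are efficient for zRC. -/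
open Finset

/-- `kmax^i_j(q)`: the `j`-th largest value of the multiset `{δ_{e,i} : e ∈ q}`
(counted with multiplicity), and `0` if `|q| < j`. -/
noncomputable def kmaxK {E : Type*} {k : ℕ} (δ : E → Fin k → ℝ) (i : Fin k) (j : ℕ)
    (q : Finset E) : ℝ :=
  ((q.val.map fun x => δ x i).sort (· ≥ ·)).getD (j - 1) 0

/-- The objective vector `zLA(q) ∈ ℝ^{(Γ_1+1)+…+(Γ_k+1)}`, the concatenation over
`i = 1,…,k` of the blocks `(∑_{e∈q} n_{e,i}, kmax^i_1(q), …, kmax^i_{Γ_i}(q))`,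
indexed by the sigma type `(i : Fin k) × Fin (Γ i + 1)`. -/
noncomputable def zLA {E : Type*} {k : ℕ} (n δ : E → Fin k → ℝ) (Γ : Fin k → ℕ)
    (q : Finset E) : ((i : Fin k) × Fin (Γ i + 1)) → ℝ :=
  fun p => if (p.2 : ℕ) = 0 then ∑ x ∈ q, n x p.1 else kmaxK δ p.1 (p.2 : ℕ) q

theorem List.sum_range_getD_eq_sum_take_s18 (L : List ℝ) (m : ℕ) :
    ∑ j ∈ Finset.range m, L.getD j 0 = (L.take m).sum := by
  induction L generalizing m with
  | nil => simp
  | cons a t ih =>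
    cases m with
    | zero => simp
    | succ m =>
      rw [Finset.sum_range_succ']
      simp only [List.getD_cons_succ, List.getD_cons_zero, List.take_succ_cons, List.sum_cons]
      rw [ih, add_comm]

/-- In a nonincreasing list of nonnegative reals, no submultiset of cardinality at most `m` has a
sum larger than that of the first `m` entries. -/
theorem Multiset.sum_le_sum_take_of_pairwise_ge (L : List ℝ) (hL : L.Pairwise (· ≥ ·))
    (h0 : ∀ a ∈ L, 0 ≤ a) (m : ℕ) (M : Multiset ℝ) (hM : M ≤ (L : Multiset ℝ))
    (hc : Multiset.card M ≤ m) : M.sum ≤ (L.take m).sum := by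
  induction L generalizing m M with
  | nil =>
    have : M = 0 := by simpa using hM
    simp [this]
  | cons a t ih =>
    rw [List.pairwise_cons] at hL
    rcases Multiset.empty_or_exists_mem M with rfl | ⟨b₀, hb₀⟩
    · simpa using List.sum_nonneg fun x hx => h0 x (List.mem_of_mem_take hx)
    have key : ∃ b M', M = b ::ₘ M' ∧ b ≤ a ∧ M' ≤ (t : Multiset ℝ) := by
      rw [← Multiset.cons_coe] at hM
      by_cases ha : a ∈ M
      · obtain ⟨M', rfl⟩ := Multiset.exists_cons_of_mem ha
        exact ⟨a, M', rfl, le_rfl, (Multiset.cons_le_cons_iff a).1 hM⟩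
      · have hMt := (Multiset.le_cons_of_notMem ha).1 hM
        obtain ⟨M', rfl⟩ := Multiset.exists_cons_of_mem hb₀
        exact ⟨b₀, M', rfl, hL.1 b₀ (by simpa using Multiset.mem_of_le hMt hb₀),
          (Multiset.le_cons_self _ _).trans hMt⟩
    obtain ⟨b, M', rfl, hba, hM'⟩ := key
    cases m with
    | zero => simp at hc
    | succ m =>
      have := ih hL.2 (fun x hx => h0 x (List.mem_cons_of_mem _ hx)) m M' hM' (by simpa using hc)
      simp only [Multiset.sum_cons, List.take_succ_cons, List.sum_cons]
      linarith

theorem Finset.exists_subset_map_val_eq {α β : Type*} (f : α → β) (q : Finset α)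
    (M : Multiset β) (hM : M ≤ q.val.map f) : ∃ S ⊆ q, S.val.map f = M := by
  classical
  induction q using Finset.induction_on generalizing M with
  | empty => exact ⟨∅, subset_rfl, (by simpa using hM : M = 0).symm⟩
  | insert a q ha ih =>
    rw [Finset.insert_val_of_notMem ha, Multiset.map_cons] at hM
    by_cases hfa : f a ∈ M
    · obtain ⟨M', rfl⟩ := Multiset.exists_cons_of_mem hfa
      obtain ⟨S, hSq, rfl⟩ := ih M' ((Multiset.cons_le_cons_iff _).1 hM)
      refine ⟨insert a S, Finset.insert_subset_insert a hSq, ?_⟩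
      rw [Finset.insert_val_of_notMem fun h => ha (hSq h), Multiset.map_cons]
    · obtain ⟨S, hSq, rfl⟩ := ih M ((Multiset.le_cons_of_notMem hfa).1 hM)
      exact ⟨S, hSq.trans (Finset.subset_insert a q), rfl⟩

theorem sum_range_kmaxK {E : Type*} {k : ℕ} (δ : E → Fin k → ℝ) (i : Fin k) (m : ℕ)
    (q : Finset E) :
    ∑ j ∈ Finset.range m, kmaxK δ i (j + 1) q =
      (((q.val.map fun x => δ x i).sort (· ≥ ·)).take m).sum := by
  simp only [kmaxK, Nat.add_sub_cancel, List.sum_range_getD_eq_sum_take_s18]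

section WorstCase

variable {E : Type*} [Fintype E] [DecidableEq E] {k : ℕ} (n δ : E → Fin k → ℝ)

theorem sum_le_of_mem_Uk (hδ : ∀ x i, 0 ≤ δ x i) (Γ : Fin k → ℕ)
    (q : Finset E) (i : Fin k) {c : E → Fin k → ℝ} (hc : c ∈ Uk n δ Γ) :
    ∑ e ∈ q, c e i ≤
      ∑ e ∈ q, n e i + ∑ j ∈ Finset.range (Γ i), kmaxK δ i (j + 1) q := by
  set S := q.filter fun e => n e i < c e i with hS
  have h1 : ∑ e ∈ q, c e i ≤ ∑ e ∈ q, n e i + ∑ e ∈ S, δ e i := by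
    rw [hS, Finset.sum_filter, ← Finset.sum_add_distrib]
    refine Finset.sum_le_sum fun e _ => ?_
    split_ifs with h
    · exact (hc.1 e i).2
    · linarith
  have h2 : ∑ e ∈ S, δ e i ≤ ∑ j ∈ Finset.range (Γ i), kmaxK δ i (j + 1) q := by
    rw [sum_range_kmaxK]
    refine Multiset.sum_le_sum_take_of_pairwise_ge _ (Multiset.pairwise_sort _ _) ?_ _
      (S.val.map fun x => δ x i) ?_ ?_
    · intro a ha
      simp only [Multiset.mem_sort, Multiset.mem_map] at ha
      obtain ⟨x, -, rfl⟩ := ha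
      exact hδ x i
    · rw [Multiset.sort_eq]
      exact Multiset.map_le_map (Finset.val_le_iff.2 (Finset.filter_subset _ _))
    · rw [Multiset.card_map]
      exact (Finset.card_le_card (Finset.filter_subset_filter _ (Finset.subset_univ q))).trans
        (hc.2 i)
  linarith

theorem exists_mem_Uk_sum_eq (hδ : ∀ x i, 0 ≤ δ x i) (Γ : Fin k → ℕ)
    (q : Finset E) (i : Fin k) :
    ∃ c ∈ Uk n δ Γ, ∑ e ∈ q, n e i + ∑ j ∈ Finset.range (Γ i), kmaxK δ i (j + 1) q =
      ∑ e ∈ q, c e i := by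
  set L := (q.val.map fun x => δ x i).sort (· ≥ ·) with hL
  obtain ⟨S, hSq, hS⟩ := Finset.exists_subset_map_val_eq (fun x => δ x i) q
    (L.take (Γ i) : Multiset ℝ) (by
      rw [← Multiset.sort_eq (q.val.map fun x => δ x i) (· ≥ ·), ← hL]
      exact Multiset.coe_le.2 (List.take_sublist _ _).subperm)
  have hcard : S.card ≤ Γ i := by
    have := congrArg Multiset.card hS
    simp only [Multiset.card_map, Multiset.coe_card, List.length_take] at this
    exact this.le.trans (min_le_left _ _)
  have hsum : ∑ e ∈ S, δ e i = (L.take (Γ i)).sum := by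
    rw [Finset.sum, hS, Multiset.sum_coe]
  refine ⟨fun e i' => n e i' + if e ∈ S ∧ i' = i then δ e i' else 0, ⟨fun e i' => ?_, fun i' => ?_⟩,
    ?_⟩
  · have := hδ e i'
    dsimp only
    constructor <;> split_ifs <;> linarith
  · by_cases hi : i' = i
    · subst hi
      refine (Finset.card_le_card fun e he => ?_).trans hcard
      by_contra h
      simp [h] at he
    · simp [hi]
  · rw [sum_range_kmaxK, ← hL, ← hsum, Finset.sum_add_distrib]
    simp only [and_true]
    rw [Finset.sum_ite_mem, Finset.inter_eq_right.2 hSq]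

/-- The worst-case cost is the nominal cost plus the sum of the `Γ i` largest interval lengths. -/
theorem zRCk_eq_sum_add_sum_kmaxK (hδ : ∀ x i, 0 ≤ δ x i) (Γ : Fin k → ℕ)
    (q : Finset E) (i : Fin k) :
    zRCk n δ Γ q i =
      ∑ e ∈ q, n e i + ∑ j ∈ Finset.range (Γ i), kmaxK δ i (j + 1) q := by
  refine IsGreatest.csSup_eq ⟨exists_mem_Uk_sum_eq n δ hδ Γ q i, ?_⟩
  rintro _ ⟨c, hc, rfl⟩
  exact sum_le_of_mem_Uk n δ hδ Γ q i hc

theorem zRCk_le_of_zLA_le (hδ : ∀ x i, 0 ≤ δ x i) (Γ : Fin k → ℕ)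
    {q q' : Finset E} (h : zLA n δ Γ q' ≤ zLA n δ Γ q) :
    zRCk n δ Γ q' ≤ zRCk n δ Γ q := by
  intro i
  rw [zRCk_eq_sum_add_sum_kmaxK n δ hδ, zRCk_eq_sum_add_sum_kmaxK n δ hδ]
  refine add_le_add ?_ (Finset.sum_le_sum fun j hj => ?_)
  · simpa [zLA] using h ⟨i, 0⟩
  · have hj' : j + 1 < Γ i + 1 := Nat.succ_lt_succ (Finset.mem_range.1 hj)
    simpa [zLA] using h ⟨i, ⟨j + 1, hj'⟩⟩

end WorstCase

theorem exists_efficient_le {E ι : Type*} [Finite E] (Q : Set (Finset E))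
    (f : Finset E → ι → ℝ) {q : Finset E} (hq : q ∈ Q) :
    ∃ q', Efficient Q f q' ∧ f q' ≤ f q := by
  obtain ⟨y, hy, hmin⟩ := (Q.toFinite.image f).exists_le_minimal (Set.mem_image_of_mem f hq)
  obtain ⟨q', hq', rfl⟩ := hmin.prop
  refine ⟨q', ⟨hq', fun p hp hdom => hdom.2 ?_⟩, hy⟩
  exact le_antisymm hdom.1 (hmin.le_of_le (Set.mem_image_of_mem f hp) hdom.1)

/-- If `Q' ⊆ Q` is a complete set of efficient solutions for `min_{q∈Q} zLA(q)`, then for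
every efficient solution `q` of the robust counterpart there exists `q' ∈ Q'` with
`zRC(q') = zRC(q)`; consequently the members of `Q'` that are efficient for `zRC` form a
complete set of robust efficient solutions. -/
theorem stmt18 {E : Type*} [Fintype E] [DecidableEq E] [Nonempty E] {k : ℕ} (hk : 0 < k)
    (Q : Set (Finset E)) (hQ : Q.Nonempty)
    (n δ : E → Fin k → ℝ) (hδ : ∀ x i, 0 ≤ δ x i)
    (Γ : Fin k → ℕ) (hΓ1 : ∀ i, 1 ≤ Γ i) (hΓ2 : ∀ i, Γ i ≤ Fintype.card E)
    (Q' : Set (Finset E)) (hQ' : CompleteEff Q (zLA n δ Γ) Q') :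
    (∀ q : Finset E, Efficient Q (zRCk n δ Γ) q →
      ∃ q' ∈ Q', zRCk n δ Γ q' = zRCk n δ Γ q) ∧
    CompleteEff Q (zRCk n δ Γ) {q | q ∈ Q' ∧ Efficient Q (zRCk n δ Γ) q} := by
  have hcover : ∀ q : Finset E, Efficient Q (zRCk n δ Γ) q →
      ∃ q' ∈ Q', zRCk n δ Γ q' = zRCk n δ Γ q := by
    intro q hq
    obtain ⟨q', hq', h⟩ := hQ'.2.2 q hq.1
    have hle : zLA n δ Γ q' ≤ zLA n δ Γ q := h.elim (fun hd => hd.1) fun he => he.le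
    refine ⟨q', hq', ?_⟩
    by_contra hne
    exact hq.2 q' (hQ'.1 hq') ⟨zRCk_le_of_zLA_le n δ hδ Γ hle, hne⟩
  refine ⟨hcover, fun q hq => hQ'.1 hq.1, fun q hq => hq.2, fun q hq => ?_⟩
  obtain ⟨p, hp, hpq⟩ := exists_efficient_le Q (zRCk n δ Γ) hq
  obtain ⟨q', hq', heq⟩ := hcover p hp
  refine ⟨q', ⟨hq', hQ'.1 hq', heq ▸ hp.2⟩, ?_⟩
  rw [← heq] at hpq
  exact (em (zRCk n δ Γ q' = zRCk n δ Γ q)).elim Or.inr fun hne => Or.inl ⟨hpq, hne⟩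
end

section
/- Let i ≥ 1 and let A, B, B′, C ⊆ E be such that A, B, C are pairwise disjoint and A, B′, C are pairwise disjoint. If kmax_j(B′) ≤ kmax_j(B) for every j = 1, …, i, then kmax_i(A ∪ B′ ∪ C) ≤ kmax_i(A ∪ B ∪ C). -/
open Finset

theorem List.le_getD_iff_lt_countP {t : ℝ} (ht : 0 < t) (l : List ℝ)
    (hl : l.Pairwise (· ≥ ·)) (k : ℕ) :
    t ≤ l.getD k 0 ↔ k < l.countP (fun x => t ≤ x) := by
  induction l generalizing k with
  | nil => simp [ht]
  | cons a l ih =>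
    rw [List.pairwise_cons] at hl
    by_cases ha : t ≤ a
    · cases k with
      | zero => simp [ha]
      | succ k => simpa [List.countP_cons, ha] using ih hl.2 k
    · have hc : l.countP (fun x => t ≤ x) = 0 := by
        rw [List.countP_eq_zero]
        intro x hx
        have := hl.1 x hx
        simp only [decide_eq_true_eq]
        linarith
      cases k with
      | zero => simp [ha, hc]
      | succ k => simpa [ha, hc] using ih hl.2 k

theorem le_kmax_iff {E : Type*} (δ : E → ℝ) {t : ℝ} (ht : 0 < t) {j : ℕ} (hj : 1 ≤ j)
    (q : Finset E) : t ≤ kmax δ j q ↔ j ≤ #{e ∈ q | t ≤ δ e} := by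
  have hcount : ((q.val.map δ).sort (· ≥ ·)).countP (fun x => t ≤ x) =
      #{e ∈ q | t ≤ δ e} := by
    rw [← Multiset.coe_countP (fun x => t ≤ x), Multiset.sort_eq, Multiset.countP_map]
    rfl
  rw [kmax, List.le_getD_iff_lt_countP ht _ (Multiset.pairwise_sort _ _), hcount]
  omega

theorem kmax_nonneg {E : Type*} (δ : E → ℝ) (hδ : ∀ x, 0 ≤ δ x) (j : ℕ) (q : Finset E) :
    0 ≤ kmax δ j q := by
  rw [kmax, List.getD_eq_getElem?_getD]
  rcases hx : ((q.val.map δ).sort (· ≥ ·))[j - 1]? with _ | x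
  · simp
  · have hmem := List.mem_of_getElem? hx
    rw [Multiset.mem_sort, Multiset.mem_map] at hmem
    obtain ⟨e, -, rfl⟩ := hmem
    exact hδ e

theorem card_filter_union_union_middle {E : Type*} [DecidableEq E] (p : E → Prop)
    [DecidablePred p] {A B C : Finset E} (hAB : Disjoint A B) (hBC : Disjoint B C) :
    #{e ∈ A ∪ B ∪ C | p e} = #{e ∈ A ∪ C | p e} + #{e ∈ B | p e} := by
  rw [union_right_comm, filter_union, card_union_of_disjoint]
  exact disjoint_filter_filter (disjoint_union_left.2 ⟨hAB, hBC.symm⟩)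

/-- Let `i ≥ 1` and let `A, B, B', C ⊆ E` with `A, B, C` pairwise disjoint and `A, B', C`
pairwise disjoint. If `kmax_j(B') ≤ kmax_j(B)` for every `j = 1,…,i`, then
`kmax_i(A ∪ B' ∪ C) ≤ kmax_i(A ∪ B ∪ C)`. -/
theorem stmt19 {E : Type*} [Fintype E] [DecidableEq E] [Nonempty E]
    (δ : E → ℝ) (hδ : ∀ x, 0 ≤ δ x)
    (A B B' C : Finset E)
    (hAB : Disjoint A B) (hAC : Disjoint A C) (hBC : Disjoint B C)
    (hAB' : Disjoint A B') (hB'C : Disjoint B' C)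
    (i : ℕ) (hi : 1 ≤ i)
    (h : ∀ j, 1 ≤ j → j ≤ i → kmax δ j B' ≤ kmax δ j B) :
    kmax δ i (A ∪ B' ∪ C) ≤ kmax δ i (A ∪ B ∪ C) := by
  rcases (kmax_nonneg δ hδ i (A ∪ B' ∪ C)).eq_or_lt with h0 | ht
  · rw [← h0]
    exact kmax_nonneg δ hδ i _
  · have hcard := (le_kmax_iff δ ht hi _).1 le_rfl
    rw [le_kmax_iff δ ht hi, card_filter_union_union_middle _ hAB hBC]
    rw [card_filter_union_union_middle _ hAB' hB'C] at hcard
    generalize kmax δ i (A ∪ B' ∪ C) = t at ht hcard ⊢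
    have hmin : min #{e ∈ B' | t ≤ δ e} i ≤ #{e ∈ B | t ≤ δ e} := by
      rcases Nat.eq_zero_or_pos (min #{e ∈ B' | t ≤ δ e} i) with hm | hm
      · omega
      · exact (le_kmax_iff δ ht hm B).1
          (((le_kmax_iff δ ht hm B').2 (min_le_left _ _)).trans (h _ hm (min_le_right _ _)))
    omega
end
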